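/- arXiv:2111.12692 — 3 statements merged into one kernel-verified Lean document; each statement's English description precedes it below -/
import Mathlib

section
/- Let 1<p<∞ and let w be a weight on ℝⁿ with [w]_{A_{p,ℛ}}<∞; set σ := w^{1-p'}. Let 1<r<∞ be defined by r' = 2^{n+1} p' [σ]_{A_{∞,ℛ}}. Then [w]_{A_{p/r,ℛ}} ≤ 2^{p-1} [w]_{A_{p,ℛ}}. -/
open MeasureTheory ENNReal NNReal Set

noncomputable section

/-- The conjugate exponent `p' = p/(p-1)`. -/
def conjExp (p : ℝ) : ℝ := p / (p - 1)
/-- An (open) axis-parallel cube in `ℝⁿ`. -/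
def IsCube (n : ℕ) (Q : Set (Fin n → ℝ)) : Prop :=
  ∃ (a : Fin n → ℝ) (r : ℝ), 0 < r ∧ Q = Set.univ.pi fun i => Set.Ioo (a i) (a i + r)

/-- An (open) axis-parallel rectangle in `ℝⁿ`. -/
def IsRect (n : ℕ) (R : Set (Fin n → ℝ)) : Prop :=
  ∃ a b : Fin n → ℝ, (∀ i, a i < b i) ∧ R = Set.univ.pi fun i => Set.Ioo (a i) (b i)

/-- The average `⨍_Q f` of a nonnegative function over a set. -/
def setAvg {n : ℕ} (Q : Set (Fin n → ℝ)) (f : (Fin n → ℝ) → ℝ≥0∞) : ℝ≥0∞ :=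
  (∫⁻ x in Q, f x) / volume Q

/-- The Hardy–Littlewood maximal operator (over axis-parallel cubes). -/
def maximal {n : ℕ} (f : (Fin n → ℝ) → ℝ≥0∞) (x : Fin n → ℝ) : ℝ≥0∞ :=
  ⨆ (Q : Set (Fin n → ℝ)) (_ : IsCube n Q) (_ : x ∈ Q), setAvg Q f

/-- The strong maximal operator (over axis-parallel rectangles). -/
def maximalR {n : ℕ} (f : (Fin n → ℝ) → ℝ≥0∞) (x : Fin n → ℝ) : ℝ≥0∞ :=
  ⨆ (R : Set (Fin n → ℝ)) (_ : IsRect n R) (_ : x ∈ R), setAvg R f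

/-- The dual weight `σ = w^{1-p'}`. -/
def dualWeight {n : ℕ} (p : ℝ) (w : (Fin n → ℝ) → ℝ≥0∞) : (Fin n → ℝ) → ℝ≥0∞ :=
  fun x => w x ^ (1 - conjExp p)

/-- The two-weight Muckenhoupt constant `[v,w]_{A_p}`. -/
def twoApConst (n : ℕ) (p : ℝ) (v w : (Fin n → ℝ) → ℝ≥0∞) : ℝ≥0∞ :=
  ⨆ (Q : Set (Fin n → ℝ)) (_ : IsCube n Q),
    setAvg Q v * setAvg Q (dualWeight p w) ^ (p - 1)

/-- The Muckenhoupt constant `[w]_{A_p}`. -/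
def ApConst (n : ℕ) (p : ℝ) (w : (Fin n → ℝ) → ℝ≥0∞) : ℝ≥0∞ := twoApConst n p w w

/-- The Fujii–Wilson constant `[w]_{A_∞}`. -/
def AinfConst (n : ℕ) (w : (Fin n → ℝ) → ℝ≥0∞) : ℝ≥0∞ :=
  ⨆ (Q : Set (Fin n → ℝ)) (_ : IsCube n Q),
    (∫⁻ x in Q, maximal (Q.indicator w) x) / ∫⁻ x in Q, w x

/-- The strong Muckenhoupt constant `[w]_{A_{p,ℛ}}`. -/
def ApRConst (n : ℕ) (p : ℝ) (w : (Fin n → ℝ) → ℝ≥0∞) : ℝ≥0∞ :=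
  ⨆ (R : Set (Fin n → ℝ)) (_ : IsRect n R),
    setAvg R w * setAvg R (dualWeight p w) ^ (p - 1)

/-- The strong Fujii–Wilson constant `[w]_{A_{∞,ℛ}}`. -/
def AinfRConst (n : ℕ) (w : (Fin n → ℝ) → ℝ≥0∞) : ℝ≥0∞ :=
  ⨆ (R : Set (Fin n → ℝ)) (_ : IsRect n R),
    (∫⁻ x in R, maximalR (R.indicator w) x) / ∫⁻ x in R, w x
open Filter Topology

section Tree
variable {n : ℕ}

def bvol (a b : Fin n → ℝ) : ℝ := ∏ i, (b i - a i)
def upL (i : Fin n) (a b : Fin n → ℝ) : Fin n → ℝ := Function.update b i ((a i + b i) / 2)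
def loR (i : Fin n) (a b : Fin n → ℝ) : Fin n → ℝ := Function.update a i ((a i + b i) / 2)

def bavg (G : (Fin n → ℝ) → (Fin n → ℝ) → ℝ) (a b : Fin n → ℝ) : ℝ := G a b / bvol a b

/-- Recursive tree functional. -/
def treeSum (G : (Fin n → ℝ) → (Fin n → ℝ) → ℝ) (φ : (Fin n → ℝ) → (Fin n → ℝ) → ℝ → ℝ) :
    List (Fin n) → (Fin n → ℝ) → (Fin n → ℝ) → ℝ → ℝ
  | [], a, b, m => φ a b (max m (bavg G a b))
  | i :: L, a, b, m =>
      treeSum G φ L a (upL i a b) (max m (bavg G a b)) +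
      treeSum G φ L (loR i a b) b (max m (bavg G a b))

/-- good boxes inside a given box -/
def GoodBox (a0 b0 a b : Fin n → ℝ) : Prop := (∀ i, a0 i ≤ a i) ∧ (∀ i, b i ≤ b0 i) ∧ ∀ i, a i < b i

lemma GoodBox.left {a0 b0 a b : Fin n → ℝ} (h : GoodBox a0 b0 a b) (i : Fin n) :
    GoodBox a0 b0 a (upL i a b) := by
  obtain ⟨h1, h2, h3⟩ := h
  refine ⟨h1, fun j => ?_, fun j => ?_⟩ <;> unfold upL <;> by_cases hj : j = i
  · subst hj; simp; linarith [h2 j, h3 j]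
  · simp [hj, h2]
  · subst hj; simp; linarith [h2 j, h3 j]
  · simp [hj, h3]

lemma GoodBox.right {a0 b0 a b : Fin n → ℝ} (h : GoodBox a0 b0 a b) (i : Fin n) :
    GoodBox a0 b0 (loR i a b) b := by
  obtain ⟨h1, h2, h3⟩ := h
  refine ⟨fun j => ?_, h2, fun j => ?_⟩ <;> unfold loR <;> by_cases hj : j = i
  · subst hj; simp; linarith [h1 j, h3 j]
  · simp [hj, h1]
  · subst hj; simp; linarith [h2 j, h3 j]
  · simp [hj, h3]

lemma GoodBox.trans {a0 b0 a b a' b' : Fin n → ℝ} (h : GoodBox a0 b0 a b) (h' : GoodBox a b a' b') :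
    GoodBox a0 b0 a' b' :=
  ⟨fun i => (h.1 i).trans (h'.1 i), fun i => (h'.2.1 i).trans (h.2.1 i), h'.2.2⟩

lemma GoodBox.self {a0 b0 a b : Fin n → ℝ} (h : GoodBox a0 b0 a b) : GoodBox a b a b :=
  ⟨fun _ => le_rfl, fun _ => le_rfl, h.2.2⟩

lemma GoodBox.vol_pos {a0 b0 a b : Fin n → ℝ} (h : GoodBox a0 b0 a b) : 0 < bvol a b :=
  Finset.prod_pos fun i _ => sub_pos.2 (h.2.2 i)

lemma bvol_left (i : Fin n) (a b : Fin n → ℝ) : bvol a (upL i a b) = bvol a b / 2 := by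
  unfold bvol upL
  rw [← Finset.mul_prod_erase _ _ (Finset.mem_univ i), ← Finset.mul_prod_erase _ (fun j => b j - a j) (Finset.mem_univ i)]
  rw [Finset.prod_congr rfl (g := fun j => b j - a j)]
  · simp; ring
  · intro j hj; simp [Finset.ne_of_mem_erase hj]

lemma bvol_right (i : Fin n) (a b : Fin n → ℝ) : bvol (loR i a b) b = bvol a b / 2 := by
  unfold bvol loR
  rw [← Finset.mul_prod_erase _ _ (Finset.mem_univ i), ← Finset.mul_prod_erase _ (fun j => b j - a j) (Finset.mem_univ i)]
  rw [Finset.prod_congr rfl (g := fun j => b j - a j)]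
  · simp; ring
  · intro j hj; simp [Finset.ne_of_mem_erase hj]

/-- The elementary inequality. -/
lemma elem_ineq {e m f : ℝ} (he : 0 < e) (he1 : e ≤ 1) (hm : 0 < m) (hmf : m ≤ f) (hf : f ≤ 2 * m) :
    (f ^ e - m ^ e) * f ≤ (2 * e / (1 + e)) * (f ^ (1 + e) - m ^ (1 + e)) := by
  have hfp : 0 < f := hm.trans_le hmf
  obtain ⟨u, hu⟩ : ∃ u, u = f / m := ⟨_, rfl⟩
  have hfu : f = u * m := by rw [hu]; field_simp
  have hu1 : 1 ≤ u := by rw [hu, le_div_iff₀ hm]; linarith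
  have hu2 : u ≤ 2 := by rw [hu, div_le_iff₀ hm]; linarith
  have hB := rpow_one_add_le_one_add_mul_self (s := u - 1) (by linarith) he.le he1
  rw [show 1 + (u - 1) = u by ring] at hB
  have hup : 0 < u := by linarith
  rw [Real.rpow_add hm, Real.rpow_add hfp, Real.rpow_one, Real.rpow_one, hfu,
    Real.mul_rpow hup.le hm.le]
  set U := u ^ e
  set Y := m ^ e
  have hY : 0 < Y := Real.rpow_pos_of_pos hm e
  have hU : 0 < U := Real.rpow_pos_of_pos hup e
  have key : (U - 1) * u * (1 + e) ≤ 2 * e * (u * U - 1) := by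
    have h1 : u * U * (1 - e) ≤ u * (1 + e * (u - 1)) * (1 - e) := by
      have : 0 ≤ 1 - e := by linarith
      gcongr
    have h2 : 0 ≤ (u - 1) * (2 - u) := mul_nonneg (by linarith) (by linarith)
    have h3 := mul_nonneg h2 he.le
    have h4 : 0 ≤ e * e * (u * (u-1)) := by
      have : 0 ≤ u - 1 := by linarith
      positivity
    nlinarith
  rw [div_mul_eq_mul_div, le_div_iff₀ (by linarith)]
  have := mul_le_mul_of_nonneg_left key (mul_pos hY hm).le
  nlinarith

variable (G : (Fin n → ℝ) → (Fin n → ℝ) → ℝ) (a0 b0 : Fin n → ℝ)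

lemma bavg_child (hG0 : ∀ a b, GoodBox a0 b0 a b → 0 ≤ G a b)
    (hGadd : ∀ a b i, GoodBox a0 b0 a b → G a b = G a (upL i a b) + G (loR i a b) b)
    {a b : Fin n → ℝ} (h : GoodBox a0 b0 a b) (i : Fin n) :
    bavg G a (upL i a b) ≤ 2 * bavg G a b ∧ bavg G (loR i a b) b ≤ 2 * bavg G a b := by
  unfold bavg
  rw [bvol_left, bvol_right]
  have hv := h.vol_pos
  have h1 := hG0 _ _ (h.left i)
  have h2 := hG0 _ _ (h.right i)
  have h3 := hGadd a b i h
  constructor <;> rw [show 2 * (G a b / bvol a b) = G a b / (bvol a b / 2) by field_simp] <;>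
    gcongr <;> linarith

lemma tree1 (hG0 : ∀ a b, GoodBox a0 b0 a b → 0 ≤ G a b)
    (hGadd : ∀ a b i, GoodBox a0 b0 a b → G a b = G a (upL i a b) + G (loR i a b) b)
    {e : ℝ} (he : 0 < e) (he1 : e ≤ 1) (L : List (Fin n)) :
    ∀ a b m, GoodBox a0 b0 a b → 0 < m → bavg G a b ≤ 2 * m →
      treeSum G (fun a b m => G a b * m ^ e) L a b m + 2 * e / (1 + e) * m ^ (1 + e) * bvol a b ≤
        m ^ e * G a b + 2 * e / (1 + e) * treeSum G (fun a b m => bvol a b * m ^ (1 + e)) L a b m := by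
  have step : ∀ a b m, GoodBox a0 b0 a b → 0 < m → bavg G a b ≤ 2 * m → ∀ X Y : ℝ,
      X + 2 * e / (1 + e) * (max m (bavg G a b)) ^ (1 + e) * bvol a b ≤
        (max m (bavg G a b)) ^ e * G a b + 2 * e / (1 + e) * Y →
      X + 2 * e / (1 + e) * m ^ (1 + e) * bvol a b ≤ m ^ e * G a b + 2 * e / (1 + e) * Y := by
    intro a b m hg hm hf X Y hXY
    rcases le_total (bavg G a b) m with h | h
    · rwa [max_eq_left h] at hXY
    · rw [max_eq_right h] at hXY
      have hv := hg.vol_pos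
      have hGe : G a b = bavg G a b * bvol a b := by unfold bavg; field_simp
      have := mul_le_mul_of_nonneg_right (elem_ineq he he1 hm h hf) hv.le
      rw [hGe] at hXY ⊢
      nlinarith
  induction L with
  | nil =>
    intro a b m hg hm hf
    apply step a b m hg hm hf
    simp only [treeSum]
    apply le_of_eq; ring
  | cons i L ih =>
    intro a b m hg hm hf
    apply step a b m hg hm hf
    simp only [treeSum]
    have hM : 0 < max m (bavg G a b) := lt_max_of_lt_left hm
    have hc := bavg_child G a0 b0 hG0 hGadd hg i
    have hle : bavg G a b ≤ max m (bavg G a b) := le_max_right _ _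
    have h1 := ih _ _ _ (hg.left i) hM (by linarith [hc.1])
    have h2 := ih _ _ _ (hg.right i) hM (by linarith [hc.2])
    rw [bvol_left] at h1
    rw [bvol_right] at h2
    rw [hGadd a b i hg]
    nlinarith

lemma tree2 (hG0 : ∀ a b, GoodBox a0 b0 a b → 0 ≤ G a b)
    (hGadd : ∀ a b i, GoodBox a0 b0 a b → G a b = G a (upL i a b) + G (loR i a b) b)
    {A : ℝ} (hA : 0 ≤ A)
    (hT : ∀ L a b, GoodBox a0 b0 a b → ∀ m, m ≤ bavg G a b → 0 < G a b →
      treeSum G (fun a b m => bvol a b * m) L a b m ≤ A * G a b)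
    {e : ℝ} (he : 0 < e) (he1 : e ≤ 1) (L : List (Fin n)) :
    ∀ a b m, GoodBox a0 b0 a b → 0 < m → bavg G a b ≤ 2 * m →
      treeSum G (fun a b m => bvol a b * m ^ (1 + e)) L a b m
        + A * (2 * e / (1 + e)) * m ^ (1 + e) * bvol a b ≤
      m ^ e * treeSum G (fun a b m => bvol a b * m) L a b m
        + A * (2 * e / (1 + e)) * treeSum G (fun a b m => bvol a b * m ^ (1 + e)) L a b m := by
  have step : ∀ a b m, GoodBox a0 b0 a b → 0 < m → bavg G a b ≤ 2 * m → ∀ X T : ℝ,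
      (m ≤ bavg G a b → T ≤ A * G a b) →
      X + A * (2 * e / (1 + e)) * (max m (bavg G a b)) ^ (1 + e) * bvol a b ≤
        (max m (bavg G a b)) ^ e * T + A * (2 * e / (1 + e)) * X →
      X + A * (2 * e / (1 + e)) * m ^ (1 + e) * bvol a b ≤
        m ^ e * T + A * (2 * e / (1 + e)) * X := by
    intro a b m hg hm hf X T hTT hXY
    rcases le_total (bavg G a b) m with h | h
    · rwa [max_eq_left h] at hXY
    · rw [max_eq_right h] at hXY
      have hv := hg.vol_pos
      have hGe : G a b = bavg G a b * bvol a b := by unfold bavg; field_simp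
      have h1 := mul_le_mul_of_nonneg_right (elem_ineq he he1 hm h hf) hv.le
      have h1' := mul_le_mul_of_nonneg_left h1 hA
      have h2 := hTT h
      rw [hGe] at h2
      have h3 : 0 ≤ bavg G a b ^ e - m ^ e := sub_nonneg.2 (Real.rpow_le_rpow hm.le h he.le)
      have h4 := mul_le_mul_of_nonneg_left h2 h3
      nlinarith
  have hpos : ∀ a b m, GoodBox a0 b0 a b → 0 < m → m ≤ bavg G a b → 0 < G a b := by
    intro a b m hg hm h
    have hv := hg.vol_pos
    have hGe : G a b = bavg G a b * bvol a b := by unfold bavg; field_simp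
    rw [hGe]; exact mul_pos (hm.trans_le h) hv
  induction L with
  | nil =>
    intro a b m hg hm hf
    apply step a b m hg hm hf
    · intro h; exact hT _ _ _ hg _ h (hpos _ _ _ hg hm h)
    have hM : 0 < max m (bavg G a b) := lt_max_of_lt_left hm
    simp only [treeSum]
    rw [Real.rpow_add hM, Real.rpow_one]
    apply le_of_eq; ring
  | cons i L ih =>
    intro a b m hg hm hf
    apply step a b m hg hm hf
    · intro h; exact hT _ _ _ hg _ h (hpos _ _ _ hg hm h)
    simp only [treeSum]
    have hM : 0 < max m (bavg G a b) := lt_max_of_lt_left hm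
    have hc := bavg_child G a0 b0 hG0 hGadd hg i
    have hle : bavg G a b ≤ max m (bavg G a b) := le_max_right _ _
    have h1 := ih _ _ _ (hg.left i) hM (by linarith [hc.1])
    have h2 := ih _ _ _ (hg.right i) hM (by linarith [hc.2])
    rw [bvol_left] at h1
    rw [bvol_right] at h2
    nlinarith

lemma tree_final (hG0 : ∀ a b, GoodBox a0 b0 a b → 0 ≤ G a b)
    (hGadd : ∀ a b i, GoodBox a0 b0 a b → G a b = G a (upL i a b) + G (loR i a b) b)
    {A : ℝ} (hA : 0 ≤ A)
    (hT : ∀ L a b, GoodBox a0 b0 a b → ∀ m, m ≤ bavg G a b → 0 < G a b →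
      treeSum G (fun a b m => bvol a b * m) L a b m ≤ A * G a b)
    {e : ℝ} (he : 0 < e) (he1 : e ≤ 1) (hAe : A * (2 * e / (1 + e)) ≤ 1 / 2) (L : List (Fin n))
    (hab : GoodBox a0 b0 a0 b0) (hpos : 0 < G a0 b0) :
    treeSum G (fun a b m => G a b * m ^ e) L a0 b0 (bavg G a0 b0) ≤
      2 * (bavg G a0 b0 ^ e * G a0 b0) := by
  have hv := hab.vol_pos
  have hf : 0 < bavg G a0 b0 := div_pos hpos hv
  have h1 := tree1 G a0 b0 hG0 hGadd he he1 L a0 b0 _ hab hf (by linarith)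
  have h2 := tree2 G a0 b0 hG0 hGadd hA hT he he1 L a0 b0 _ hab hf (by linarith)
  have h3 := hT L a0 b0 hab _ le_rfl hpos
  have hGe : bavg G a0 b0 ^ (1 + e) * bvol a0 b0 = bavg G a0 b0 ^ e * G a0 b0 := by
    rw [Real.rpow_add hf, Real.rpow_one]; unfold bavg; field_simp
  set W := treeSum G (fun a b m => G a b * m ^ e) L a0 b0 (bavg G a0 b0)
  set S := treeSum G (fun a b m => bvol a b * m ^ (1 + e)) L a0 b0 (bavg G a0 b0)
  set T := treeSum G (fun a b m => bvol a b * m) L a0 b0 (bavg G a0 b0)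
  set c := 2 * e / (1 + e)
  have hc : 0 < c := by positivity
  have hF : 0 < bavg G a0 b0 ^ e := Real.rpow_pos_of_pos hf e
  rw [mul_assoc, hGe] at h1 h2
  have h4 : bavg G a0 b0 ^ e * T ≤ bavg G a0 b0 ^ e * (A * G a0 b0) := by gcongr
  set K := bavg G a0 b0 ^ e * G a0 b0 with hK
  have hKp : 0 < K := mul_pos hF hpos
  have h5 : S + A * c * K ≤ A * K + A * c * S := by
    calc _ ≤ _ := h2
      _ ≤ _ := by rw [hK]; linarith
  -- c * S ≤ K + c K
  have h6 : c * S * (1 - A * c) ≤ A * c * K * (1 - c) := by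
    have := mul_le_mul_of_nonneg_left h5 hc.le
    nlinarith
  have h7 : c * S ≤ K + c * K := by
    by_contra hcon
    push Not at hcon
    have : (K + c * K) * (1 - A * c) < c * S * (1 - A * c) := by
      apply mul_lt_mul_of_pos_right hcon; linarith
    have h8 : 0 ≤ A * c := by positivity
    nlinarith [mul_pos hc hKp, mul_nonneg h8 hKp.le]
  linarith

end Tree

section Meas
variable {n : ℕ}

def boxI (a b : Fin n → ℝ) : Set (Fin n → ℝ) := Set.univ.pi fun i => Set.Ico (a i) (b i)
def boxJ (a b : Fin n → ℝ) : Set (Fin n → ℝ) := Set.univ.pi fun i => Set.Ioo (a i) (b i)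

lemma measurableSet_boxI (a b : Fin n → ℝ) : MeasurableSet (boxI a b) :=
  MeasurableSet.univ_pi fun _ => measurableSet_Ico

lemma measurableSet_boxJ (a b : Fin n → ℝ) : MeasurableSet (boxJ a b) :=
  MeasurableSet.univ_pi fun _ => measurableSet_Ioo

lemma boxI_ae_boxJ (a b : Fin n → ℝ) : (boxI a b : Set (Fin n → ℝ)) =ᵐ[volume] boxJ a b :=
  (Measure.univ_pi_Ico_ae_eq_Icc (μ := fun _ : Fin n => (volume : Measure ℝ))).trans
    (Measure.univ_pi_Ioo_ae_eq_Icc (μ := fun _ : Fin n => (volume : Measure ℝ))).symm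

lemma boxI_ae_Icc (a b : Fin n → ℝ) : (boxI a b : Set (Fin n → ℝ)) =ᵐ[volume] Set.Icc a b :=
  (Measure.univ_pi_Ico_ae_eq_Icc (μ := fun _ : Fin n => (volume : Measure ℝ)))

lemma boxJ_mono {a0 b0 a b : Fin n → ℝ} (h : GoodBox a0 b0 a b) : boxJ a b ⊆ boxJ a0 b0 :=
  Set.pi_mono fun i _ => Set.Ioo_subset_Ioo (h.1 i) (h.2.1 i)

lemma boxI_mono {a0 b0 a b : Fin n → ℝ} (h : GoodBox a0 b0 a b) : boxI a b ⊆ boxI a0 b0 :=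
  Set.pi_mono fun i _ => Set.Ico_subset_Ico (h.1 i) (h.2.1 i)

lemma mem_left_iff (i : Fin n) {a b x : Fin n → ℝ} (h : ∀ i, a i < b i) :
    x ∈ boxI a (upL i a b) ↔ x ∈ boxI a b ∧ x i < (a i + b i) / 2 := by
  simp only [boxI, upL, Set.mem_univ_pi, Set.mem_Ico]
  constructor
  · intro hx
    have hi := hx i
    simp at hi
    refine ⟨fun j => ?_, hi.2⟩
    by_cases hj : j = i
    · subst hj; exact ⟨hi.1, by linarith [h j]⟩
    · simpa [hj] using hx j
  · rintro ⟨hx, hi⟩ j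
    by_cases hj : j = i
    · subst hj; simpa [hi] using (hx j).1
    · simpa [hj] using hx j

lemma mem_right_iff (i : Fin n) {a b x : Fin n → ℝ} (h : ∀ i, a i < b i) :
    x ∈ boxI (loR i a b) b ↔ x ∈ boxI a b ∧ (a i + b i) / 2 ≤ x i := by
  simp only [boxI, loR, Set.mem_univ_pi, Set.mem_Ico]
  constructor
  · intro hx
    have hi := hx i
    simp at hi
    refine ⟨fun j => ?_, hi.1⟩
    by_cases hj : j = i
    · subst hj; exact ⟨by linarith [h j], hi.2⟩
    · simpa [hj] using hx j
  · rintro ⟨hx, hi⟩ j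
    by_cases hj : j = i
    · subst hj; simpa [hi] using (hx j).2
    · simpa [hj] using hx j

lemma boxI_split (i : Fin n) {a b : Fin n → ℝ} (h : ∀ i, a i < b i) (f : (Fin n → ℝ) → ℝ≥0∞) :
    ∫⁻ x in boxI a b, f x =
      (∫⁻ x in boxI a (upL i a b), f x) + ∫⁻ x in boxI (loR i a b) b, f x := by
  rw [← lintegral_union (measurableSet_boxI _ _)]
  · congr 2
    ext x
    rw [Set.mem_union, mem_left_iff i h, mem_right_iff i h, ← and_or_left]
    simp [lt_or_ge]
  · rw [Set.disjoint_left]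
    intro x h1 h2
    rw [mem_left_iff i h] at h1
    rw [mem_right_iff i h] at h2
    linarith [h1.2, h2.2]

lemma vol_boxI {a b : Fin n → ℝ} (h : ∀ i, a i < b i) : volume (boxI a b) = ENNReal.ofReal (bvol a b) := by
  unfold boxI bvol
  rw [Real.volume_pi_Ico, ENNReal.ofReal_prod_of_nonneg]
  intro i _; linarith [h i]

lemma vol_boxJ {a b : Fin n → ℝ} (h : ∀ i, a i < b i) : volume (boxJ a b) = ENNReal.ofReal (bvol a b) := by
  rw [← measure_congr (boxI_ae_boxJ a b), vol_boxI h]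

variable (σ : (Fin n → ℝ) → ℝ≥0∞)

def mass (a b : Fin n → ℝ) : ℝ := (∫⁻ x in boxI a b, σ x).toReal

lemma ofReal_bavg {a0 b0 a b : Fin n → ℝ} (hfin : ∫⁻ x in boxI a0 b0, σ x ≠ ∞)
    (h : GoodBox a0 b0 a b) :
    ENNReal.ofReal (bavg (mass σ) a b) = (∫⁻ x in boxI a b, σ x) / ENNReal.ofReal (bvol a b) := by
  have : ∫⁻ x in boxI a b, σ x ≠ ∞ :=
    ((lintegral_mono_set (boxI_mono h)).trans_lt hfin.lt_top).ne
  unfold bavg mass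
  rw [ENNReal.ofReal_div_of_pos h.vol_pos, ENNReal.ofReal_toReal this]

lemma treeT_le {a0 b0 : Fin n → ℝ} (hfin : ∫⁻ x in boxI a0 b0, σ x ≠ ∞)
    (h : (Fin n → ℝ) → ℝ≥0∞) (L : List (Fin n)) :
    ∀ a b m, GoodBox a0 b0 a b → 0 ≤ m → (∀ x ∈ boxJ a b, ENNReal.ofReal m ≤ h x) →
      (∀ a' b', GoodBox a b a' b' → ∀ x ∈ boxJ a' b', ENNReal.ofReal (bavg (mass σ) a' b') ≤ h x) →
      0 ≤ treeSum (mass σ) (fun a b m => bvol a b * m) L a b m ∧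
      ENNReal.ofReal (treeSum (mass σ) (fun a b m => bvol a b * m) L a b m) ≤
        ∫⁻ x in boxI a b, h x := by
  induction L with
  | nil =>
    intro a b m hg hm h1 h2
    simp only [treeSum]
    have hv := hg.vol_pos
    refine ⟨mul_nonneg hv.le (hm.trans (le_max_left _ _)), ?_⟩
    rw [setLIntegral_congr (boxI_ae_boxJ a b), ENNReal.ofReal_mul hv.le, ← vol_boxJ hg.2.2, mul_comm,
      ← setLIntegral_const]
    apply setLIntegral_mono' (measurableSet_boxJ _ _)
    intro x hx
    rcases max_choice m (bavg (mass σ) a b) with h' | h' <;> rw [h']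
    · exact h1 x hx
    · exact h2 _ _ hg.self x hx
  | cons i L ih =>
    intro a b m hg hm h1 h2
    simp only [treeSum]
    have hm' : 0 ≤ max m (bavg (mass σ) a b) := hm.trans (le_max_left _ _)
    have h3 : ∀ x ∈ boxJ a b, ENNReal.ofReal (max m (bavg (mass σ) a b)) ≤ h x := by
      intro x hx
      rcases max_choice m (bavg (mass σ) a b) with h' | h' <;> rw [h']
      · exact h1 x hx
      · exact h2 _ _ hg.self x hx
    have hl := hg.self.left i
    have hr := hg.self.right i
    have k1 := ih _ _ _ (hg.left i) hm' (fun x hx => h3 x (boxJ_mono hl hx))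
      (fun a' b' h' x hx => h2 a' b' (hl.trans h') x hx)
    have k2 := ih _ _ _ (hg.right i) hm' (fun x hx => h3 x (boxJ_mono hr hx))
      (fun a' b' h' x hx => h2 a' b' (hr.trans h') x hx)
    refine ⟨add_nonneg k1.1 k2.1, ?_⟩
    rw [ENNReal.ofReal_add k1.1 k2.1, boxI_split i hg.2.2]
    exact add_le_add k1.2 k2.2

/-- the cell containing a point -/
def cell : List (Fin n) → (Fin n → ℝ) → (Fin n → ℝ) → (Fin n → ℝ) → (Fin n → ℝ) × (Fin n → ℝ)
  | [], a, b, _ => (a, b)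
  | i :: L, a, b, x =>
    if x i < (a i + b i) / 2 then cell L a (upL i a b) x else cell L (loR i a b) b x

def cellAvg (L : List (Fin n)) (a b x : Fin n → ℝ) : ℝ≥0∞ :=
  ENNReal.ofReal (bavg (mass σ) (cell L a b x).1 (cell L a b x).2)

lemma measurable_cellAvg (L : List (Fin n)) : ∀ a b, Measurable (cellAvg σ L a b) := by
  induction L with
  | nil => intro a b; unfold cellAvg; simp only [cell]; exact measurable_const
  | cons i L ih =>
    intro a b
    have : cellAvg σ (i :: L) a b = fun x => if x i < (a i + b i) / 2 then
        cellAvg σ L a (upL i a b) x else cellAvg σ L (loR i a b) b x := by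
      ext x
      unfold cellAvg
      simp only [cell]
      split_ifs <;> rfl
    rw [this]
    exact Measurable.ite (measurableSet_lt (measurable_pi_apply i) measurable_const) (ih _ _) (ih _ _)

lemma cell_good (L : List (Fin n)) : ∀ a b x, GoodBox a b a b → x ∈ boxI a b →
    GoodBox a b (cell L a b x).1 (cell L a b x).2 ∧ x ∈ boxI (cell L a b x).1 (cell L a b x).2 ∧
    ∀ i, (cell L a b x).2 i - (cell L a b x).1 i = (b i - a i) / 2 ^ (L.count i) := by
  induction L with
  | nil => intro a b x h hx; simp [cell, h, hx]
  | cons i L ih =>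
    intro a b x h hx
    simp only [cell]
    split_ifs with hlt
    · have hl := h.left i
      obtain ⟨k1, k2, k3⟩ := ih a (upL i a b) x hl.self ((mem_left_iff i h.2.2).2 ⟨hx, hlt⟩)
      refine ⟨hl.trans k1, k2, fun j => ?_⟩
      rw [k3 j]
      by_cases hj : j = i
      · subst hj; simp [upL, pow_succ]; field_simp; ring
      · rw [List.count_cons_of_ne (Ne.symm hj)]; simp [upL, hj]
    · have hl := h.right i
      obtain ⟨k1, k2, k3⟩ := ih (loR i a b) b x hl.self ((mem_right_iff i h.2.2).2 ⟨hx, not_lt.1 hlt⟩)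
      refine ⟨hl.trans k1, k2, fun j => ?_⟩
      rw [k3 j]
      by_cases hj : j = i
      · subst hj; simp [loR, pow_succ]; field_simp; ring
      · rw [List.count_cons_of_ne (Ne.symm hj)]; simp [loR, hj]

lemma treeW_ge (hσ : Measurable σ) {a0 b0 : Fin n → ℝ} (hfin : ∫⁻ x in boxI a0 b0, σ x ≠ ∞)
    {e : ℝ} (he : 0 < e) (L : List (Fin n)) :
    ∀ a b m, GoodBox a0 b0 a b → 0 ≤ m →
      0 ≤ treeSum (mass σ) (fun a b m => mass σ a b * m ^ e) L a b m ∧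
      ∫⁻ x in boxI a b, σ x * cellAvg σ L a b x ^ e ≤
      ENNReal.ofReal (treeSum (mass σ) (fun a b m => mass σ a b * m ^ e) L a b m) := by
  induction L with
  | nil =>
    intro a b m hg hm
    have hm' : 0 ≤ max m (bavg (mass σ) a b) := hm.trans (le_max_left _ _)
    have hG : 0 ≤ mass σ a b := ENNReal.toReal_nonneg
    have : ∫⁻ x in boxI a b, σ x ≠ ∞ :=
      ((lintegral_mono_set (boxI_mono hg)).trans_lt hfin.lt_top).ne
    simp only [treeSum, cellAvg, cell]
    refine ⟨mul_nonneg hG (Real.rpow_nonneg hm' e), ?_⟩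
    rw [lintegral_mul_const _ hσ, ENNReal.ofReal_mul hG, ← ENNReal.ofReal_rpow_of_nonneg hm' he.le]
    rw [mass, ENNReal.ofReal_toReal this]
    gcongr
    exact le_max_right _ _
  | cons i L ih =>
    intro a b m hg hm
    simp only [treeSum]
    have hm' : 0 ≤ max m (bavg (mass σ) a b) := hm.trans (le_max_left _ _)
    have k1 := ih _ _ _ (hg.left i) hm'
    have k2 := ih _ _ _ (hg.right i) hm'
    refine ⟨add_nonneg k1.1 k2.1, ?_⟩
    rw [ENNReal.ofReal_add k1.1 k2.1, boxI_split i hg.2.2]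
    refine le_trans (le_of_eq ?_) (add_le_add k1.2 k2.2)
    congr 1
    · apply setLIntegral_congr_fun (measurableSet_boxI _ _)
      intro x hx
      have := ((mem_left_iff i hg.2.2).1 hx).2
      simp [cellAvg, cell, this]
    · apply setLIntegral_congr_fun (measurableSet_boxI _ _)
      intro x hx
      have := ((mem_right_iff i hg.2.2).1 hx).2
      simp [cellAvg, cell, not_lt.2 this]

end Meas

section RH
variable {n : ℕ}

def dirs (n J : ℕ) : List (Fin n) := (List.replicate J (List.finRange n)).flatten

lemma count_dirs (J : ℕ) (i : Fin n) : (dirs n J).count i = J := by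
  unfold dirs
  have h1 : (List.finRange n).count i = 1 :=
    List.count_eq_one_of_mem (List.nodup_finRange n) (List.mem_finRange i)
  induction J with
  | zero => simp
  | succ J ih => rw [List.replicate_succ, List.flatten_cons, List.count_append, ih, h1]; ring

lemma cellAvg_tendsto (σ : (Fin n → ℝ) → ℝ≥0∞) (hσ : Measurable σ) {a b : Fin n → ℝ}
    (hab : GoodBox a b a b) (hfin : ∫⁻ x in boxI a b, σ x ≠ ∞) :
    ∀ᵐ x, x ∈ boxI a b →
      Tendsto (fun J => cellAvg σ (dirs n J) a b x) atTop (𝓝 (σ x)) := by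
  obtain ⟨δ, hδ0, hδ⟩ : ∃ δ : ℝ, 0 < δ ∧ ∀ i, b i - a i ≤ δ := by
    refine ⟨1 + ∑ i, (b i - a i), ?_, fun i => ?_⟩
    · have : 0 ≤ ∑ i, (b i - a i) := Finset.sum_nonneg fun i _ => by linarith [hab.2.2 i]
      linarith
    · have := Finset.single_le_sum (f := fun i => b i - a i) (s := Finset.univ)
        (fun i _ => by linarith [hab.2.2 i]) (Finset.mem_univ i)
      linarith
  have hv := hab.vol_pos
  have hvδ : bvol a b ≤ δ ^ n := by
    have := Finset.prod_le_prod (s := Finset.univ) (f := fun i => b i - a i) (g := fun _ : Fin n => δ)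
      (fun i _ => by linarith [hab.2.2 i]) (fun i _ => hδ i)
    simpa [bvol] using this
  set C : ℝ≥0 := Real.toNNReal ((6 * δ) ^ n / bvol a b) with hC
  have hCcoe : (C : ℝ≥0∞) = ENNReal.ofReal ((6 * δ) ^ n / bvol a b) := rfl
  have hC6 : (6 : ℝ) ^ n ≤ (6 * δ) ^ n / bvol a b := by
    rw [le_div_iff₀ hv, mul_pow]; gcongr
  have hdoub : ∀ x : Fin n → ℝ, ∃ᶠ r in 𝓝[>] (0:ℝ),
      volume (Metric.closedBall x (3 * r)) ≤ C * volume (Metric.closedBall x r) := by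
    intro x
    apply Eventually.frequently
    filter_upwards [self_mem_nhdsWithin] with r hr
    have hr : 0 < r := hr
    rw [Real.volume_pi_closedBall _ (by positivity), Real.volume_pi_closedBall _ hr.le, hCcoe,
      ← ENNReal.ofReal_mul (by positivity)]
    apply ENNReal.ofReal_le_ofReal
    rw [Fintype.card_fin]
    calc (2 * (3 * r)) ^ n = 6 ^ n * r ^ n := by rw [← mul_pow]; ring
      _ ≤ (6 * δ) ^ n / bvol a b * (2 * r) ^ n := by gcongr; linarith
  set v := Vitali.vitaliFamily (volume : Measure (Fin n → ℝ)) C hdoub with hvdef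
  have hf := v.ae_tendsto_lintegral_div' (f := (boxI a b).indicator σ)
    (hσ.indicator (measurableSet_boxI a b))
    (by rw [lintegral_indicator (measurableSet_boxI a b)]; exact hfin)
  filter_upwards [hf] with x hx hxI
  rw [Set.indicator_of_mem hxI] at hx
  have hcell := fun J => cell_good (dirs n J) a b x hab hxI
  have hsub : ∀ J, Set.Icc (cell (dirs n J) a b x).1 (cell (dirs n J) a b x).2 ⊆
      Metric.closedBall x (δ / 2 ^ J) := by
    intro J y hy
    obtain ⟨h1, h2, h3⟩ := hcell J
    rw [Metric.mem_closedBall, dist_pi_le_iff (by positivity)]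
    intro i
    have h3i := h3 i
    rw [count_dirs] at h3i
    have h2i := h2 i (Set.mem_univ i)
    have hy1 := hy.1 i
    have hy2 := hy.2 i
    have : (b i - a i) / 2 ^ J ≤ δ / 2 ^ J := by gcongr; exact hδ i
    rw [Real.dist_eq, abs_le]
    constructor <;> linarith [h2i.1, h2i.2]
  have htend : Tendsto (fun J => Set.Icc (cell (dirs n J) a b x).1 (cell (dirs n J) a b x).2) atTop
      (v.filterAt x) := by
    rw [VitaliFamily.tendsto_filterAt_iff]
    constructor
    · refine Eventually.of_forall fun J => ?_
      obtain ⟨h1, h2, h3⟩ := hcell J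
      refine ⟨isClosed_Icc, ?_, δ / 2 ^ J, hsub J, ?_⟩
      · have hne : (boxJ (cell (dirs n J) a b x).1 (cell (dirs n J) a b x).2).Nonempty :=
          Set.univ_pi_nonempty_iff.2 fun i => Set.nonempty_Ioo.2 (h1.2.2 i)
        have hop : IsOpen (boxJ (cell (dirs n J) a b x).1 (cell (dirs n J) a b x).2) :=
          isOpen_set_pi Set.finite_univ fun i _ => isOpen_Ioo
        refine hne.mono (interior_maximal ?_ hop)
        intro y hy
        exact ⟨fun i => (hy i trivial).1.le, fun i => (hy i trivial).2.le⟩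
      · rw [← measure_congr (boxI_ae_Icc _ _), vol_boxI h1.2.2,
          Real.volume_pi_closedBall _ (by positivity), hCcoe, ← ENNReal.ofReal_mul (by positivity)]
        apply ENNReal.ofReal_le_ofReal
        have : bvol (cell (dirs n J) a b x).1 (cell (dirs n J) a b x).2 =
            bvol a b / (2 ^ J) ^ n := by
          unfold bvol
          rw [Finset.prod_congr rfl (fun i _ => h3 i)]
          simp [count_dirs, Finset.prod_div_distrib]
        rw [this, Fintype.card_fin]
        apply le_of_eq
        rw [show 2 * (3 * (δ / 2 ^ J)) = (6 * δ) / 2 ^ J by ring, div_pow]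
        field_simp
    · intro ε hε
      have ht : Tendsto (fun J : ℕ => δ / 2 ^ J) atTop (𝓝 0) := by
        have := (tendsto_pow_atTop_nhds_zero_of_lt_one (r := (1/2 : ℝ)) (by norm_num)
          (by norm_num)).const_mul δ
        simpa [div_eq_mul_inv] using this
      filter_upwards [ht.eventually (eventually_le_nhds hε)] with J hJ
      exact (hsub J).trans (Metric.closedBall_subset_closedBall hJ)
  refine (hx.comp htend).congr fun J => ?_
  obtain ⟨h1, h2, h3⟩ := hcell J
  simp only [Function.comp]
  rw [← measure_congr (boxI_ae_Icc _ _), ← setLIntegral_congr (boxI_ae_Icc _ _), vol_boxI h1.2.2,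
    cellAvg, ofReal_bavg σ hfin h1]
  congr 1
  apply setLIntegral_congr_fun (measurableSet_boxI _ _)
  intro y hy
  exact Set.indicator_of_mem (boxI_mono h1 hy) _

lemma isRect_boxJ {a b : Fin n → ℝ} (h : ∀ i, a i < b i) : IsRect n (boxJ a b) := ⟨a, b, h, rfl⟩

lemma ofReal_bavg_le_maximal (σ : (Fin n → ℝ) → ℝ≥0∞) {a0 b0 : Fin n → ℝ}
    (hfin : ∫⁻ x in boxI a0 b0, σ x ≠ ∞) {a b a' b' : Fin n → ℝ}
    (h0 : GoodBox a0 b0 a b) (h : GoodBox a b a' b') {x : Fin n → ℝ} (hx : x ∈ boxJ a' b') :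
    ENNReal.ofReal (bavg (mass σ) a' b') ≤ maximalR ((boxJ a b).indicator σ) x := by
  have h1 : setAvg (boxJ a' b') ((boxJ a b).indicator σ) ≤ maximalR ((boxJ a b).indicator σ) x :=
    le_iSup_of_le (boxJ a' b') (le_iSup_of_le (isRect_boxJ h.2.2) (le_iSup_of_le hx le_rfl))
  refine le_trans (le_of_eq ?_) h1
  rw [ofReal_bavg σ hfin (h0.trans h), setAvg, vol_boxJ h.2.2, setLIntegral_congr (boxI_ae_boxJ _ _)]
  congr 1
  apply setLIntegral_congr_fun (measurableSet_boxJ _ _)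
  intro y hy
  exact (Set.indicator_of_mem (boxJ_mono h hy) _).symm

/-- A finite Fujii–Wilson bound controls the maximal function. -/
lemma maximal_bound (σ : (Fin n → ℝ) → ℝ≥0∞) {A : ℝ≥0∞} (hA : AinfRConst n σ ≤ A)
    {a b : Fin n → ℝ} (h : ∀ i, a i < b i) (h0 : ∫⁻ x in boxI a b, σ x ≠ 0)
    (hfin : ∫⁻ x in boxI a b, σ x ≠ ∞) :
    ∫⁻ x in boxI a b, maximalR ((boxJ a b).indicator σ) x ≤ A * ∫⁻ x in boxI a b, σ x := by
  have h1 : (∫⁻ x in boxJ a b, maximalR ((boxJ a b).indicator σ) x) / ∫⁻ x in boxJ a b, σ x ≤ A :=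
    le_trans (le_iSup₂ (f := fun (R : Set (Fin n → ℝ)) (_ : IsRect n R) =>
      (∫⁻ x in R, maximalR (R.indicator σ) x) / ∫⁻ x in R, σ x) (boxJ a b) (isRect_boxJ h)) hA
  rw [← setLIntegral_congr (boxI_ae_boxJ a b), ← setLIntegral_congr (boxI_ae_boxJ a b)] at h1
  rwa [ENNReal.div_le_iff h0 hfin] at h1

lemma one_le_A (σ : (Fin n → ℝ) → ℝ≥0∞) {A : ℝ≥0∞} (hA : AinfRConst n σ ≤ A)
    {a b : Fin n → ℝ} (hab : GoodBox a b a b) (h0 : ∫⁻ x in boxI a b, σ x ≠ 0)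
    (hfin : ∫⁻ x in boxI a b, σ x ≠ ∞) : 1 ≤ A := by
  have h1 := maximal_bound σ hA hab.2.2 h0 hfin
  have h2 : ∫⁻ x in boxI a b, σ x ≤ ∫⁻ x in boxI a b, maximalR ((boxJ a b).indicator σ) x := by
    rw [setLIntegral_congr (boxI_ae_boxJ a b) (f := maximalR _)]
    calc ∫⁻ x in boxI a b, σ x = ENNReal.ofReal (bavg (mass σ) a b) * volume (boxJ a b) := by
          rw [ofReal_bavg σ hfin hab, vol_boxJ hab.2.2, ENNReal.div_mul_cancel]
          · simpa using hab.vol_pos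
          · simp
      _ = ∫⁻ x in boxJ a b, ENNReal.ofReal (bavg (mass σ) a b) := (setLIntegral_const _ _).symm
      _ ≤ _ := by
          apply setLIntegral_mono' (measurableSet_boxJ _ _)
          intro x hx
          exact ofReal_bavg_le_maximal σ hfin hab hab hx
  have h3 := h2.trans h1
  by_contra hlt
  push Not at hlt
  have : A * ∫⁻ x in boxI a b, σ x < 1 * ∫⁻ x in boxI a b, σ x :=
    ENNReal.mul_lt_mul_left h0 hfin hlt
  rw [one_mul] at this
  exact absurd h3 (not_le.2 this)

lemma reverse_holder (σ : (Fin n → ℝ) → ℝ≥0∞) (hσ : Measurable σ) {A : ℝ} (hA0 : 0 ≤ A)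
    (hA : AinfRConst n σ ≤ ENNReal.ofReal A) {e : ℝ} (he : 0 < e) (he1 : e ≤ 1)
    (hAe : A * (2 * e / (1 + e)) ≤ 1 / 2)
    {a b : Fin n → ℝ} (hab : GoodBox a b a b) (h0 : ∫⁻ x in boxI a b, σ x ≠ 0)
    (hfin : ∫⁻ x in boxI a b, σ x ≠ ∞) :
    setAvg (boxI a b) (fun x => σ x ^ (1 + e)) ≤ 2 * setAvg (boxI a b) σ ^ (1 + e) := by
  have hfin' : ∀ a' b', GoodBox a b a' b' → ∫⁻ x in boxI a' b', σ x ≠ ∞ := fun a' b' h =>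
    ((lintegral_mono_set (boxI_mono h)).trans_lt hfin.lt_top).ne
  have hG0 : ∀ a' b', GoodBox a b a' b' → 0 ≤ mass σ a' b' := fun _ _ _ => ENNReal.toReal_nonneg
  have hGadd : ∀ a' b' i, GoodBox a b a' b' →
      mass σ a' b' = mass σ a' (upL i a' b') + mass σ (loR i a' b') b' := by
    intro a' b' i h
    unfold mass
    rw [boxI_split i h.2.2, ENNReal.toReal_add (hfin' _ _ (h.left i)) (hfin' _ _ (h.right i))]
  have hT : ∀ L a' b', GoodBox a b a' b' → ∀ m, m ≤ bavg (mass σ) a' b' → 0 < mass σ a' b' →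
      treeSum (mass σ) (fun a b m => bvol a b * m) L a' b' m ≤ A * mass σ a' b' := by
    intro L a' b' h m hm hpos
    have hmono : treeSum (mass σ) (fun a b m => bvol a b * m) L a' b' m =
        treeSum (mass σ) (fun a b m => bvol a b * m) L a' b' (bavg (mass σ) a' b') := by
      cases L <;> simp [treeSum, max_eq_right hm]
    rw [hmono]
    have hne : ∫⁻ x in boxI a' b', σ x ≠ 0 := by
      intro h; simp [mass, h] at hpos
    have k := treeT_le σ hfin (maximalR ((boxJ a' b').indicator σ)) L a' b' (bavg (mass σ) a' b') h
      (div_nonneg hpos.le h.vol_pos.le)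
      (fun x hx => ofReal_bavg_le_maximal σ hfin h h.self hx)
      (fun a'' b'' h'' x hx => ofReal_bavg_le_maximal σ hfin h h'' hx)
    have k2 := k.2.trans (maximal_bound σ hA h.2.2 hne (hfin' _ _ h))
    rw [← ENNReal.ofReal_toReal (hfin' _ _ h), ← ENNReal.ofReal_mul hA0] at k2
    exact (ENNReal.ofReal_le_ofReal_iff (mul_nonneg hA0 ENNReal.toReal_nonneg)).1 k2
  have hpos : 0 < mass σ a b := ENNReal.toReal_pos h0 hfin
  have hv := hab.vol_pos
  have hf : 0 < bavg (mass σ) a b := div_pos hpos hv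
  have hW : ∀ J, ∫⁻ x in boxI a b, σ x * cellAvg σ (dirs n J) a b x ^ e ≤
      ENNReal.ofReal (2 * (bavg (mass σ) a b ^ e * mass σ a b)) := by
    intro J
    refine (treeW_ge σ hσ hfin he (dirs n J) a b (bavg (mass σ) a b) hab hf.le).2.trans ?_
    exact ENNReal.ofReal_le_ofReal
      (tree_final (mass σ) a b hG0 hGadd hA0 hT he he1 hAe (dirs n J) hab hpos)
  have hlim : ∫⁻ x in boxI a b, σ x ^ (1 + e) ≤
      ENNReal.ofReal (2 * (bavg (mass σ) a b ^ e * mass σ a b)) := by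
    have hae : ∀ᵐ x ∂(volume.restrict (boxI a b)), σ x ^ (1 + e) =
        liminf (fun J => σ x * cellAvg σ (dirs n J) a b x ^ e) atTop := by
      have h1 := (ae_restrict_iff' (measurableSet_boxI a b)).2 (cellAvg_tendsto σ hσ hab hfin)
      have h2 := ae_lt_top hσ hfin
      filter_upwards [h1, h2] with x hx hxt
      have : Tendsto (fun J => σ x * cellAvg σ (dirs n J) a b x ^ e) atTop (𝓝 (σ x * σ x ^ e)) := by
        apply ENNReal.Tendsto.const_mul
        · exact (ENNReal.continuous_rpow_const.tendsto _).comp hx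
        · right; exact hxt.ne
      rw [this.liminf_eq, ENNReal.rpow_add_of_nonneg _ _ zero_le_one he.le, ENNReal.rpow_one]
    rw [lintegral_congr_ae hae]
    refine (lintegral_liminf_le fun J => hσ.mul ((measurable_cellAvg σ _ a b).pow_const e)).trans ?_
    refine (liminf_le_liminf (Eventually.of_forall hW)).trans ?_
    simp
  have hS : setAvg (boxI a b) σ = ENNReal.ofReal (bavg (mass σ) a b) := by
    rw [ofReal_bavg σ hfin hab, setAvg, vol_boxI hab.2.2]
  rw [hS, setAvg, vol_boxI hab.2.2, ENNReal.div_le_iff (by simpa using hv) (by simp)]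
  refine hlim.trans (le_of_eq ?_)
  rw [ENNReal.ofReal_rpow_of_pos hf, show (2 : ℝ≥0∞) = ENNReal.ofReal 2 by simp,
    ← ENNReal.ofReal_mul (by norm_num), ← ENNReal.ofReal_mul (by positivity)]
  congr 1
  rw [Real.rpow_add hf, Real.rpow_one]
  have : mass σ a b = bavg (mass σ) a b * bvol a b := by unfold bavg; field_simp
  linear_combination (2 * bavg (mass σ) a b ^ e) * this

end RH

/-- Openness of the strong `A_{p,ℛ}` condition: if `r' = 2^{n+1} p' [σ]_{A_{∞,ℛ}}`,
then `[w]_{A_{p/r,ℛ}} ≤ 2^{p-1}[w]_{A_{p,ℛ}}`. -/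
theorem strong_Ap_openness (n : ℕ) (p : ℝ) (hp : 1 < p)
    (w : (Fin n → ℝ) → ℝ≥0∞) (hw : Measurable w) (hfin : ApRConst n p w ≠ ∞)
    (r : ℝ) (hr1 : 1 < r) (hrp : r < p)
    (hrdef : ENNReal.ofReal (r / (r - 1)) =
      2 ^ (n + 1) * ENNReal.ofReal (conjExp p) * AinfRConst n (dualWeight p w)) :
    ApRConst n (p / r) w ≤ (2 : ℝ≥0∞) ^ (p - 1) * ApRConst n p w := by
  have hp1 : 0 < p - 1 := by linarith
  have hr0 : 0 < r - 1 := by linarith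
  have hpr : 0 < p - r := by linarith
  have hrpos : 0 < r := by linarith
  have hq1 : 0 < p / r - 1 := by rw [sub_pos, lt_div_iff₀ hrpos]; linarith
  have hqp : p / r - 1 ≤ p - 1 := by
    have : p / r ≤ p := div_le_self (by linarith) hr1.le
    linarith
  obtain ⟨s, hs⟩ : ∃ s, s = r * (p - 1) / (p - r) := ⟨_, rfl⟩
  have hs0 : 0 < s := by rw [hs]; positivity
  have hsq : s * (p / r - 1) = p - 1 := by rw [hs]; field_simp
  have hdual : dualWeight (p / r) w = fun x => dualWeight p w x ^ s := by
    ext x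
    unfold dualWeight
    rw [← ENNReal.rpow_mul]
    congr 1
    unfold conjExp
    have : p / r - 1 ≠ 0 := hq1.ne'
    rw [hs]
    have e1 : p / r / (p / r - 1) = p / (p - r) := by field_simp
    rw [e1]
    field_simp
    ring
  have hσ : Measurable (dualWeight p w) := hw.pow_const _
  have hRH : ∀ a b : Fin n → ℝ, GoodBox a b a b →
      ∫⁻ x in boxI a b, dualWeight p w x ≠ 0 → ∫⁻ x in boxI a b, dualWeight p w x ≠ ∞ →
      setAvg (boxI a b) (fun x => dualWeight p w x ^ s) ≤
        2 * setAvg (boxI a b) (dualWeight p w) ^ s := by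
    intro a b hab h0 h1
    generalize dualWeight p w = σ at *
    have hcp : 0 < conjExp p := div_pos (by linarith) hp1
    have hc0 : ENNReal.ofReal (conjExp p) ≠ 0 := by simpa using hcp
    have hAtop : AinfRConst n σ ≠ ∞ := by
      intro h
      rw [h, ENNReal.mul_top] at hrdef
      · exact ENNReal.ofReal_ne_top hrdef
      · simp [hcp]
    obtain ⟨A, hA⟩ : ∃ A, A = (AinfRConst n σ).toReal := ⟨_, rfl⟩
    have hAA : AinfRConst n σ = ENNReal.ofReal A := by rw [hA, ENNReal.ofReal_toReal hAtop]
    have hA0 : 0 ≤ A := by rw [hA]; exact ENNReal.toReal_nonneg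
    have hA1 : 1 ≤ A := by
      have := one_le_A σ hAA.le hab h0 h1
      rwa [ENNReal.one_le_ofReal] at this
    have hreal : r / (r - 1) = 2 ^ (n + 1) * conjExp p * A := by
      have := congrArg ENNReal.toReal hrdef
      rw [ENNReal.toReal_ofReal (by positivity)] at this
      rw [this, ENNReal.toReal_mul, ENNReal.toReal_mul, ← hA, ENNReal.toReal_ofReal hcp.le]
      simp
    rcases Nat.eq_zero_or_pos n with hn | hn
    · subst hn
      have hx : ∀ x : Fin 0 → ℝ, x = a := fun x => Subsingleton.elim _ _
      have hvol : volume (boxI a b) = 1 := by rw [vol_boxI hab.2.2]; simp [bvol]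
      have hc : ∀ f : (Fin 0 → ℝ) → ℝ≥0∞, setAvg (boxI a b) f = f a := by
        intro f
        have : f = fun _ => f a := by ext x; rw [hx x]
        rw [this, setAvg, setLIntegral_const, hvol]; simp
      rw [hc, hc]
      exact le_mul_of_one_le_left (zero_le) (by norm_num)
    · obtain ⟨e, he⟩ : ∃ e, e = s - 1 := ⟨_, rfl⟩
      have hepos : e = p * (r - 1) / (p - r) := by rw [he, hs]; field_simp; ring
      have he0 : 0 < e := by rw [hepos]; positivity
      have hee : 2 ^ (n + 1) * A * e = 1 + e := by
        have h2 : 2 ^ (n + 1) * A = r * (p - 1) / ((r - 1) * p) := by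
          unfold conjExp at hreal
          field_simp at hreal ⊢
          linarith
        rw [h2, hepos]
        field_simp
        ring
      have h2n : (2 : ℝ) ^ 2 ≤ 2 ^ (n + 1) := by
        apply pow_le_pow_right₀ (by norm_num); omega
      have h4 : 4 * (A * e) ≤ 1 + e := by
        rw [← hee, mul_assoc]
        have : 0 ≤ A * e := by positivity
        nlinarith
      have hk : 1 * e ≤ A * e := by gcongr
      have := reverse_holder σ hσ hA0 hAA.le he0 (by linarith) (by
        rw [← mul_div_assoc, div_le_iff₀ (by linarith)]; linarith) hab h0 h1
      rwa [show 1 + e = s by rw [he]; ring] at this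
  unfold ApRConst
  refine iSup₂_le fun R hR => ?_
  obtain ⟨a, b, hlt, rfl⟩ := hR
  have hab : GoodBox a b a b := ⟨fun _ => le_rfl, fun _ => le_rfl, hlt⟩
  have hJI : ∀ f, setAvg (boxJ a b) f = setAvg (boxI a b) f := by
    intro f
    unfold setAvg
    rw [measure_congr (boxI_ae_boxJ a b), setLIntegral_congr (boxI_ae_boxJ a b)]
  have hvol0 : volume (boxI a b) ≠ 0 := by
    rw [vol_boxI hlt]; simpa using hab.vol_pos
  have hvolt : volume (boxI a b) ≠ ∞ := by rw [vol_boxI hlt]; simp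
  have hK : setAvg (boxJ a b) w * setAvg (boxJ a b) (dualWeight p w) ^ (p - 1) ≤ ApRConst n p w :=
    le_iSup₂ (f := fun (R : Set (Fin n → ℝ)) (_ : IsRect n R) =>
      setAvg R w * setAvg R (dualWeight p w) ^ (p - 1)) (boxJ a b) (isRect_boxJ hlt)
  change setAvg (boxJ a b) w * setAvg (boxJ a b) (dualWeight (p / r) w) ^ (p / r - 1) ≤
    2 ^ (p - 1) * ApRConst n p w
  rw [hJI, hJI] at hK ⊢
  rw [hdual]
  by_cases h0 : ∫⁻ x in boxI a b, dualWeight p w x = 0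
  · have : setAvg (boxI a b) (fun x => dualWeight p w x ^ s) = 0 := by
      rw [lintegral_eq_zero_iff hσ] at h0
      have h1 : ∫⁻ x in boxI a b, dualWeight p w x ^ s = 0 := by
        rw [lintegral_eq_zero_iff (hσ.pow_const s)]
        filter_upwards [h0] with x hx
        simp only [Pi.zero_apply] at hx ⊢
        rw [hx, ENNReal.zero_rpow_of_pos hs0]
      rw [setAvg, h1, ENNReal.zero_div]
    rw [this, ENNReal.zero_rpow_of_pos hq1, mul_zero]
    exact zero_le
  by_cases h1 : ∫⁻ x in boxI a b, dualWeight p w x = ∞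
  · have : setAvg (boxI a b) (dualWeight p w) = ∞ := by
      rw [setAvg, h1, ENNReal.top_div_of_ne_top hvolt]
    rw [this, ENNReal.top_rpow_of_pos hp1] at hK
    have hw0 : setAvg (boxI a b) w = 0 := by
      by_contra hne
      rw [ENNReal.mul_top hne] at hK
      exact hfin (top_le_iff.1 hK)
    rw [hw0, zero_mul]
    exact zero_le
  calc setAvg (boxI a b) w * setAvg (boxI a b) (fun x => dualWeight p w x ^ s) ^ (p / r - 1)
      ≤ setAvg (boxI a b) w * (2 * setAvg (boxI a b) (dualWeight p w) ^ s) ^ (p / r - 1) := by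
        gcongr
        exact hRH a b hab h0 h1
    _ = setAvg (boxI a b) w * (2 ^ (p / r - 1) * setAvg (boxI a b) (dualWeight p w) ^ (p - 1)) := by
        rw [ENNReal.mul_rpow_of_nonneg _ _ hq1.le, ← ENNReal.rpow_mul, hsq]
    _ ≤ setAvg (boxI a b) w * (2 ^ (p - 1) * setAvg (boxI a b) (dualWeight p w) ^ (p - 1)) := by
        gcongr
        norm_num
    _ = 2 ^ (p - 1) * (setAvg (boxI a b) w * setAvg (boxI a b) (dualWeight p w) ^ (p - 1)) := by
        ring
    _ ≤ _ := by gcongr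
end
end

section
/- Let (Ω,μ) be a σ-finite measure space, let p ∈ (1,∞), q ∈ (0,∞], r ∈ (1,p), A > 0, and let v,w be weights on Ω. Let T be a positive sublinear operator on measurable functions (i.e. T maps measurable functions to nonnegative measurable functions, Tf = T|f|, T(f+g) ≤ Tf + Tg, T(λf) = λTf for λ ≥ 0, and Tf ≤ Tg whenever 0 ≤ f ≤ g) such that T1 ≤ A·1 and T is bounded from L^{p/r}(w) to L^{p/r,∞}(v) with operator norm ‖T‖_{L^{p/r}(w)→L^{p/r,∞}(v)}. Then there is an absolute constant C such that ‖T‖_{L^{p,q}(w)→L^{p,q}(v)} ≤ C(1+A)(r')^{1/p} ‖T‖_{L^{p/r}(w)→L^{p/r,∞}(v)}^{1/r} if p ≤ q ≤ ∞, and ‖T‖_{L^{p,q}(w)→L^{p,q}(v)} ≤ C(1+A)(4r'/q)^{1/q} ‖T‖_{L^{p/r}(w)→L^{p/r,∞}(v)}^{1/r} if 0 < q ≤ p. -/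
open MeasureTheory ENNReal NNReal Set

noncomputable section

/-- The weighted distribution function `w({|f| > s})`. -/
def wDist {α : Type*} [MeasurableSpace α] (μ : Measure α) (w : α → ℝ≥0∞)
    (f : α → ℝ≥0∞) (s : ℝ) : ℝ≥0∞ :=
  ∫⁻ x in {x | ENNReal.ofReal s < f x}, w x ∂μ

/-- The weighted Lorentz quasinorm `‖f‖_{L^{p,q}(w)}`; for `q = ∞` it is the weak norm. -/
def lorentzNorm {α : Type*} [MeasurableSpace α] (μ : Measure α) (w : α → ℝ≥0∞)
    (p : ℝ) (q : ℝ≥0∞) (f : α → ℝ≥0∞) : ℝ≥0∞ :=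
  if q = ∞ then ⨆ (s : ℝ) (_ : 0 < s), ENNReal.ofReal s * wDist μ w f s ^ (1 / p)
  else (ENNReal.ofReal p * ∫⁻ s in Set.Ioi (0 : ℝ),
      ENNReal.ofReal s ^ q.toReal * wDist μ w f s ^ (q.toReal / p) / ENNReal.ofReal s) ^ (1 / q.toReal)

/-- `min(p,q)` for a real `p` and an extended-real `q`. -/
def minE (p : ℝ) (q : ℝ≥0∞) : ℝ := if q = ∞ then p else min p q.toReal

/-- Multiplicative Haar measure. -/
def HH : Measure ℝ := (volume.restrict (Ioi (0:ℝ))).withDensity (fun s => (ENNReal.ofReal s)⁻¹)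

instance : SFinite HH := by unfold HH; infer_instance

lemma lintegral_HH {F : ℝ → ℝ≥0∞} (hF : Measurable F) :
    ∫⁻ s in Ioi (0:ℝ), F s / ENNReal.ofReal s = ∫⁻ s, F s ∂HH := by
  unfold HH
  rw [lintegral_withDensity_eq_lintegral_mul _ (by fun_prop) hF]
  simp [div_eq_mul_inv, mul_comm]

lemma HH_pos : ∀ᵐ s ∂HH, 0 < s := by
  have : HH ≪ volume.restrict (Ioi (0:ℝ)) := withDensity_absolutelyContinuous _ _
  exact this.ae_le (ae_restrict_mem measurableSet_Ioi)

lemma HH_scale {F : ℝ → ℝ≥0∞} (hF : Measurable F) {c : ℝ} (hc : 0 < c) :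
    ∫⁻ s, F (c * s) ∂HH = ∫⁻ s, F s ∂HH := by
  rw [← lintegral_HH hF, ← lintegral_HH (by fun_prop)]
  rw [← lintegral_indicator measurableSet_Ioi, ← lintegral_indicator measurableSet_Ioi]
  have h1 := Real.map_volume_mul_left hc.ne'
  have hm : Measurable ((Ioi (0:ℝ)).indicator fun s => F s / ENNReal.ofReal s) :=
    Measurable.indicator (by fun_prop) measurableSet_Ioi
  have h2 : ∫⁻ s, (Ioi (0:ℝ)).indicator (fun s => F s / ENNReal.ofReal s) (c * s)
      = ENNReal.ofReal |c⁻¹| * ∫⁻ s, (Ioi (0:ℝ)).indicator (fun s => F s / ENNReal.ofReal s) s := by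
    rw [← lintegral_map hm (by fun_prop), h1, lintegral_smul_measure]; rfl
  have h3 : ∀ s, (Ioi (0:ℝ)).indicator (fun s => F (c * s) / ENNReal.ofReal s) s
      = ENNReal.ofReal c * (Ioi (0:ℝ)).indicator (fun s => F s / ENNReal.ofReal s) (c * s) := by
    intro s
    by_cases hs : 0 < s
    · have hcs : 0 < c * s := by positivity
      simp only [indicator, mem_Ioi, hs, hcs, if_true]
      rw [ENNReal.ofReal_mul hc.le, div_eq_mul_inv, div_eq_mul_inv,
        ENNReal.mul_inv (by simp) (by simp), ← mul_assoc, ← mul_assoc,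
        mul_comm (ENNReal.ofReal c), mul_assoc (F _), ENNReal.mul_inv_cancel (by simpa) (by simp), mul_one]
    · have hcs : ¬ 0 < c * s := by
        intro h; exact hs (pos_of_mul_pos_right h hc.le)
      simp [indicator, hs, hcs]
  simp_rw [h3]
  rw [lintegral_const_mul _ (by fun_prop), h2, ← mul_assoc, ← ENNReal.ofReal_mul hc.le,
    abs_of_pos (by positivity), mul_inv_cancel₀ hc.ne']
  simp

lemma HH_Ioc {m x : ℝ} (hm : 0 < m) (hx : 0 < x) :
    ∫⁻ u in Ioc 0 x, ENNReal.ofReal u ^ m ∂HH = ENNReal.ofReal (x ^ m / m) := by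
  rw [← lintegral_indicator measurableSet_Ioc, ← lintegral_HH (Measurable.indicator (by fun_prop) measurableSet_Ioc)]
  have h0 : ∀ u ∈ Ioi (0:ℝ), (Ioc 0 x).indicator (fun u => ENNReal.ofReal u ^ m) u / ENNReal.ofReal u
      = (Ioc 0 x).indicator (fun u => ENNReal.ofReal (u ^ (m - 1))) u := by
    intro u hu
    have hu : 0 < u := hu
    by_cases h : u ≤ x
    · simp only [indicator, mem_Ioc, hu, h, and_self, if_true]
      rw [ENNReal.ofReal_rpow_of_pos hu, ← ENNReal.ofReal_div_of_pos hu, Real.rpow_sub_one hu.ne']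
    · simp [indicator, h]
  rw [setLIntegral_congr_fun measurableSet_Ioi h0, lintegral_indicator measurableSet_Ioc,
    Measure.restrict_restrict measurableSet_Ioc,
    inter_eq_left.2 (fun u hu => hu.1),
    ← ofReal_integral_eq_lintegral_ofReal, ← intervalIntegral.integral_of_le hx.le, integral_rpow (by left; linarith)]
  · simp [Real.zero_rpow hm.ne']
  · have := (intervalIntegral.intervalIntegrable_rpow' (a := 0) (b := x) (r := m - 1) (by linarith))
    rwa [intervalIntegrable_iff_integrableOn_Ioc_of_le hx.le] at this
  · filter_upwards [ae_restrict_mem measurableSet_Ioc] with u hu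
    exact Real.rpow_nonneg hu.1.le _

lemma HH_Ioi {b : ℝ} (hb : b < 0) :
    ∫⁻ u in Ioi 1, ENNReal.ofReal u ^ b ∂HH = ENNReal.ofReal (1 / (-b)) := by
  rw [← lintegral_indicator measurableSet_Ioi, ← lintegral_HH (Measurable.indicator (by fun_prop) measurableSet_Ioi)]
  have h0 : ∀ u ∈ Ioi (0:ℝ), (Ioi 1).indicator (fun u => ENNReal.ofReal u ^ b) u / ENNReal.ofReal u
      = (Ioi 1).indicator (fun u => ENNReal.ofReal (u ^ (b - 1))) u := by
    intro u hu
    have hu : 0 < u := hu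
    by_cases h : 1 < u
    · simp only [indicator, mem_Ioi, h, if_true]
      rw [ENNReal.ofReal_rpow_of_pos hu, ← ENNReal.ofReal_div_of_pos hu, Real.rpow_sub_one hu.ne']
    · simp [indicator, h]
  rw [setLIntegral_congr_fun measurableSet_Ioi h0, lintegral_indicator measurableSet_Ioi,
    Measure.restrict_restrict measurableSet_Ioi,
    inter_eq_left.2 (Ioi_subset_Ioi zero_le_one),
    ← ofReal_integral_eq_lintegral_ofReal, integral_Ioi_rpow_of_lt (by linarith) zero_lt_one]
  · rw [Real.one_rpow, sub_add_cancel, neg_div, div_neg]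
  · exact integrableOn_Ioi_rpow_of_lt (by linarith) zero_lt_one
  · filter_upwards [ae_restrict_mem measurableSet_Ioi] with u hu
    exact Real.rpow_nonneg (zero_lt_one.trans hu).le _

lemma HH_kernel {m p : ℝ} (hm : 0 < m) (hmp : m < p) :
    ∫⁻ u, ENNReal.ofReal m * (ENNReal.ofReal u ^ m * ENNReal.ofReal (max 1 u) ^ (-p)) ∂HH
      = ENNReal.ofReal (p / (p - m)) := by
  rw [lintegral_const_mul _ (by fun_prop)]
  have h1 : ∫⁻ u, (ENNReal.ofReal u ^ m * ENNReal.ofReal (max 1 u) ^ (-p)) ∂HH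
      = ∫⁻ u in Ioi 0, (ENNReal.ofReal u ^ m * ENNReal.ofReal (max 1 u) ^ (-p)) ∂HH := by
    rw [Measure.restrict_eq_self_of_ae_mem]
    exact HH_pos
  rw [h1, ← Ioc_union_Ioi_eq_Ioi (zero_le_one (α := ℝ)), lintegral_union measurableSet_Ioi
    (by rw [Set.disjoint_left]; intro u hu hu'; exact absurd hu.2 (not_le.2 hu'))]
  have h2 : ∫⁻ u in Ioc 0 1, (ENNReal.ofReal u ^ m * ENNReal.ofReal (max 1 u) ^ (-p)) ∂HH
      = ∫⁻ u in Ioc 0 1, ENNReal.ofReal u ^ m ∂HH := by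
    refine setLIntegral_congr_fun measurableSet_Ioc fun u hu => ?_
    simp [max_eq_left hu.2]
  have h3 : ∫⁻ u in Ioi 1, (ENNReal.ofReal u ^ m * ENNReal.ofReal (max 1 u) ^ (-p)) ∂HH
      = ∫⁻ u in Ioi 1, ENNReal.ofReal u ^ (m - p) ∂HH := by
    refine setLIntegral_congr_fun measurableSet_Ioi fun u hu => ?_
    have hu : 1 < u := hu
    simp only [max_eq_right hu.le]
    rw [← ENNReal.rpow_add _ _ (by simp; linarith) (by simp)]; rfl
  have hpm : 0 < p - m := by linarith
  rw [h2, h3, HH_Ioc hm one_pos, HH_Ioi (by linarith), ← ENNReal.ofReal_add (by positivity) (by rw [neg_sub]; positivity),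
    ← ENNReal.ofReal_mul hm.le]
  congr 1
  rw [neg_sub, Real.one_rpow]; field_simp; ring

/-- Scaling for the Lorentz integrand. -/
lemma HH_scale_pow {L : ℝ → ℝ≥0∞} (hL : Measurable L) {q a c : ℝ} (hc : 0 < c) :
    ∫⁻ s, ENNReal.ofReal s ^ q * L (s * c) ^ a ∂HH
      = ENNReal.ofReal c ^ (-q) * ∫⁻ s, ENNReal.ofReal s ^ q * L s ^ a ∂HH := by
  rw [← HH_scale (F := fun s => ENNReal.ofReal s ^ q * L s ^ a) (by fun_prop) hc,
    ← lintegral_const_mul _ (by fun_prop)]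
  refine lintegral_congr_ae ?_
  filter_upwards [HH_pos] with s hs
  have hc0 : ENNReal.ofReal c ≠ 0 := by simpa
  have : ENNReal.ofReal c ^ (-q) * ENNReal.ofReal c ^ q = 1 := by
    rw [← ENNReal.rpow_add _ _ hc0 (by simp)]; simp
  rw [ENNReal.ofReal_mul hc.le, ENNReal.mul_rpow_of_ne_top (by simp) (by simp), ← mul_assoc, ← mul_assoc, this, one_mul,
    mul_comm s c]

lemma tonelli_step {L : ℝ → ℝ≥0∞} (hL : Measurable L) {m q a : ℝ} (hm : 0 < m) (hmq : m < q) :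
    ∫⁻ s, ENNReal.ofReal s ^ q * ∫⁻ u, ENNReal.ofReal m * (ENNReal.ofReal u ^ m * L (s * max 1 u) ^ a) ∂HH ∂HH
      = ENNReal.ofReal (q / (q - m)) * ∫⁻ s, ENNReal.ofReal s ^ q * L s ^ a ∂HH := by
  have h1 : ∀ s, ENNReal.ofReal s ^ q * ∫⁻ u, ENNReal.ofReal m * (ENNReal.ofReal u ^ m * L (s * max 1 u) ^ a) ∂HH
      = ∫⁻ u, ENNReal.ofReal m * ENNReal.ofReal u ^ m * (ENNReal.ofReal s ^ q * L (s * max 1 u) ^ a) ∂HH := by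
    intro s
    rw [← lintegral_const_mul _ (by fun_prop)]
    refine lintegral_congr fun u => ?_
    ring
  simp_rw [h1]
  rw [lintegral_lintegral_swap (by fun_prop), ← HH_kernel hm hmq, ← lintegral_mul_const _ (by fun_prop)]
  refine lintegral_congr fun u => ?_
  rw [lintegral_const_mul _ (by fun_prop), HH_scale_pow hL (by positivity)]
  ring

lemma hardy_ge {L : ℝ → ℝ≥0∞} (hL : Measurable L) {m p a : ℝ} (hm : 0 < m) (hmp : m < p) (ha : 1 ≤ a) :
    ∫⁻ s, ENNReal.ofReal s ^ (p * a) *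
        (∫⁻ u, ENNReal.ofReal m * (ENNReal.ofReal u ^ m * L (s * max 1 u)) ∂HH) ^ a ∂HH
      ≤ ENNReal.ofReal (p / (p - m)) ^ a * ∫⁻ s, ENNReal.ofReal s ^ (p * a) * L s ^ a ∂HH := by
  set k : ℝ → ℝ≥0∞ := fun u => ENNReal.ofReal m * (ENNReal.ofReal u ^ m * ENNReal.ofReal (max 1 u) ^ (-p)) with hk
  have hkm : Measurable k := by fun_prop
  set κ := HH.withDensity k with hκ
  have hκu : κ univ = ENNReal.ofReal (p / (p - m)) := by
    rw [hκ, withDensity_apply _ MeasurableSet.univ, Measure.restrict_univ, HH_kernel hm hmp]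
  have ha0 : 0 < a := by linarith
  have hM : ∀ u : ℝ, ENNReal.ofReal (max 1 u) ≠ 0 := fun u => by simp
  have jensen : ∀ s, (∫⁻ u, ENNReal.ofReal m * (ENNReal.ofReal u ^ m * L (s * max 1 u)) ∂HH) ^ a
      ≤ κ univ ^ (a - 1) * ∫⁻ u, k u * (ENNReal.ofReal (max 1 u) ^ (p * a) * L (s * max 1 u) ^ a) ∂HH := by
    intro s
    have e1 : ∫⁻ u, ENNReal.ofReal m * (ENNReal.ofReal u ^ m * L (s * max 1 u)) ∂HH
        = ∫⁻ u, ENNReal.ofReal (max 1 u) ^ p * L (s * max 1 u) ∂κ := by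
      rw [hκ, lintegral_withDensity_eq_lintegral_mul _ hkm (by fun_prop)]
      refine lintegral_congr fun u => ?_
      have : ENNReal.ofReal (max 1 u) ^ (-p) * ENNReal.ofReal (max 1 u) ^ p = 1 := by
        rw [← ENNReal.rpow_add _ _ (hM u) (by simp)]; simp
      simp only [Pi.mul_apply, hk]
      calc _ = ENNReal.ofReal m * (ENNReal.ofReal u ^ m * L (s * max 1 u)) * 1 := by rw [mul_one]
        _ = _ := by rw [← this]; ring
    have e2 : ∫⁻ u, k u * (ENNReal.ofReal (max 1 u) ^ (p * a) * L (s * max 1 u) ^ a) ∂HH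
        = ∫⁻ u, (ENNReal.ofReal (max 1 u) ^ p * L (s * max 1 u)) ^ a ∂κ := by
      rw [hκ, lintegral_withDensity_eq_lintegral_mul _ hkm (by fun_prop)]
      refine lintegral_congr fun u => ?_
      simp only [Pi.mul_apply]
      rw [ENNReal.mul_rpow_of_nonneg _ _ ha0.le, ENNReal.rpow_mul]
    rw [e1, e2]
    have := eLpNorm'_le_eLpNorm'_mul_rpow_measure_univ (μ := κ) (p := 1) (q := a) zero_lt_one ha
      (f := fun u => ENNReal.ofReal (max 1 u) ^ p * L (s * max 1 u)) (by
        apply Measurable.aestronglyMeasurable; fun_prop)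
    simp only [eLpNorm', enorm_eq_self, ENNReal.rpow_one, div_one] at this
    calc _ ≤ _ := ENNReal.rpow_le_rpow this ha0.le
      _ = _ := by
        rw [ENNReal.mul_rpow_of_nonneg _ _ ha0.le, ← ENNReal.rpow_mul, ← ENNReal.rpow_mul, mul_comm]
        congr 2
        · field_simp
        · field_simp; simp
  calc _ ≤ ∫⁻ s, κ univ ^ (a - 1) * (∫⁻ u, k u * (ENNReal.ofReal (max 1 u) ^ (p * a) * (ENNReal.ofReal s ^ (p * a) * L (s * max 1 u) ^ a)) ∂HH) ∂HH := by
        refine lintegral_mono fun s => ?_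
        refine (mul_le_mul_right (jensen s) _).trans_eq ?_
        rw [mul_left_comm, ← lintegral_const_mul _ (by fun_prop)]
        congr 1
        refine lintegral_congr fun u => ?_
        ring
    _ = κ univ ^ (a - 1) * (κ univ * ∫⁻ s, ENNReal.ofReal s ^ (p * a) * L s ^ a ∂HH) := by
        rw [lintegral_const_mul _ (by fun_prop), lintegral_lintegral_swap (by fun_prop)]
        congr 1
        rw [hκu, ← HH_kernel hm hmp, ← lintegral_mul_const _ (by fun_prop)]
        refine lintegral_congr fun u => ?_
        rw [lintegral_const_mul _ (by fun_prop), lintegral_const_mul _ (by fun_prop), HH_scale_pow hL (by positivity),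
          ← mul_assoc (ENNReal.ofReal (max 1 u) ^ (p * a)), ← ENNReal.rpow_add _ _ (hM u) (by simp)]
        simp [hk]
    _ = _ := by
        rw [← mul_assoc, hκu]
        congr 1
        nth_rw 2 [← ENNReal.rpow_one (ENNReal.ofReal (p / (p - m)))]
        rw [← ENNReal.rpow_add_of_nonneg _ _ (by linarith) zero_le_one]; simp

lemma le_two_rpow {x : ℝ} : x ≤ 2 ^ x := by
  by_cases h : 1 ≤ x
  · have := one_add_mul_self_le_rpow_one_add (s := 1) (by norm_num) h
    norm_num at this; linarith
  · by_cases h0 : 0 ≤ x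
    · linarith [Real.one_le_rpow (x := 2) (by norm_num) h0]
    · linarith [Real.rpow_pos_of_pos (x := 2) (by norm_num) x]

lemma embed {φ : ℝ → ℝ≥0∞} (hφ : Antitone φ) {m a : ℝ} (hm : 0 < m) (ha : 0 < a) (ha1 : a ≤ 1) :
    (∫⁻ u, ENNReal.ofReal m * (ENNReal.ofReal u ^ m * φ u) ∂HH) ^ a
      ≤ 2 * ∫⁻ u, ENNReal.ofReal (m * a) * (ENNReal.ofReal u ^ (m * a) * φ u ^ a) ∂HH := by
  have hφm : Measurable φ := hφ.measurable
  have hma : 0 < m * a := by positivity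
  set I := ∫⁻ u, ENNReal.ofReal (m * a) * (ENNReal.ofReal u ^ (m * a) * φ u ^ a) ∂HH with hI
  have h1a : 0 ≤ 1 / a - 1 := by rw [sub_nonneg, le_div_iff₀ ha]; linarith
  have hx : ∀ x, 0 < x → ENNReal.ofReal x ^ (m * a) * φ x ^ a ≤ I := by
    intro x hx
    calc _ = ∫⁻ u in Ioc 0 x, ENNReal.ofReal (m * a) * φ x ^ a * ENNReal.ofReal u ^ (m * a) ∂HH := by
          rw [lintegral_const_mul _ (by fun_prop), HH_Ioc hma hx, mul_right_comm, ← ENNReal.ofReal_mul hma.le,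
            mul_div_cancel₀ _ hma.ne', ENNReal.ofReal_rpow_of_pos hx]
      _ ≤ ∫⁻ u in Ioc 0 x, ENNReal.ofReal (m * a) * (ENNReal.ofReal u ^ (m * a) * φ u ^ a) ∂HH := by
          refine setLIntegral_mono (by fun_prop) fun u hu => ?_
          rw [mul_assoc, mul_comm (φ x ^ a)]
          gcongr
          exact hφ hu.2
      _ ≤ I := setLIntegral_le_lintegral _ _
  have h2 : ∫⁻ u, ENNReal.ofReal m * (ENNReal.ofReal u ^ m * φ u) ∂HH ≤ ENNReal.ofReal (1 / a) * I ^ (1 / a) := by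
    calc _ ≤ ∫⁻ u, ENNReal.ofReal (1 / a) * (ENNReal.ofReal (m * a) * (ENNReal.ofReal u ^ (m * a) * φ u ^ a)) * I ^ (1 / a - 1) ∂HH := by
          refine lintegral_mono_ae ?_
          filter_upwards [HH_pos] with u hu
          have e : ENNReal.ofReal u ^ m * φ u = (ENNReal.ofReal u ^ (m * a) * φ u ^ a) ^ (1 + (1 / a - 1)) := by
            rw [add_sub_cancel, ENNReal.mul_rpow_of_nonneg _ _ (by positivity), ← ENNReal.rpow_mul, ← ENNReal.rpow_mul]
            field_simp; simp
          rw [e, ENNReal.rpow_add_of_nonneg _ _ zero_le_one h1a, ENNReal.rpow_one, ← mul_assoc (ENNReal.ofReal (1 / a)),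
            ← ENNReal.ofReal_mul (by positivity)]
          rw [show 1 / a * (m * a) = m by field_simp, mul_assoc (ENNReal.ofReal m)]
          gcongr
          exact hx u hu
      _ = _ := by
          rw [lintegral_mul_const _ (by fun_prop), lintegral_const_mul _ (by fun_prop), ← hI, mul_assoc]
          congr 1
          nth_rw 1 [← ENNReal.rpow_one I]
          rw [← ENNReal.rpow_add_of_nonneg _ _ zero_le_one h1a]; simp
  calc _ ≤ _ := ENNReal.rpow_le_rpow h2 ha.le
    _ = ENNReal.ofReal ((1 / a) ^ a) * I := by
        rw [ENNReal.mul_rpow_of_nonneg _ _ ha.le, ← ENNReal.rpow_mul, one_div_mul_cancel ha.ne', ENNReal.rpow_one,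
          ENNReal.ofReal_rpow_of_pos (by positivity)]
    _ ≤ _ := by
        gcongr
        have h3 : (1 / a) ^ a ≤ 2 := by
          have := Real.rpow_le_rpow (by positivity) (le_two_rpow (x := 1 / a)) ha.le
          rwa [← Real.rpow_mul (by norm_num), one_div_mul_cancel ha.ne', Real.rpow_one] at this
        simpa using ENNReal.ofReal_le_ofReal h3

lemma hardy_le {L : ℝ → ℝ≥0∞} (hL : Antitone L) {m p a : ℝ} (hm : 0 < m) (hmp : m < p) (ha : 0 < a) (ha1 : a ≤ 1) :
    ∫⁻ s, ENNReal.ofReal s ^ (p * a) *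
        (∫⁻ u, ENNReal.ofReal m * (ENNReal.ofReal u ^ m * L (s * max 1 u)) ∂HH) ^ a ∂HH
      ≤ 2 * ENNReal.ofReal (p / (p - m)) * ∫⁻ s, ENNReal.ofReal s ^ (p * a) * L s ^ a ∂HH := by
  have hLm := hL.measurable
  have e : p / (p - m) = (p * a) / (p * a - m * a) := by
    rw [← sub_mul, mul_div_mul_right _ _ ha.ne']
  rw [e, mul_assoc, ← tonelli_step hLm (by positivity) (by gcongr), ← lintegral_const_mul _ (by fun_prop)]
  refine lintegral_mono_ae ?_
  filter_upwards [HH_pos] with s hs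
  rw [mul_left_comm]
  gcongr
  refine embed (φ := fun u => L (s * max 1 u)) ?_ hm ha ha1
  intro x y hxy
  apply hL
  gcongr


lemma wDist_anti {α : Type*} [MeasurableSpace α] (μ : Measure α) (w f : α → ℝ≥0∞) :
    Antitone (wDist μ w f) := by
  intro s t hst
  unfold wDist
  exact lintegral_mono_set fun x (hx : ENNReal.ofReal t < f x) =>
    (lt_of_le_of_lt (ENNReal.ofReal_le_ofReal hst) hx : ENNReal.ofReal s < f x)

lemma lorentz_fin {α : Type*} [MeasurableSpace α] (μ : Measure α) (w f : α → ℝ≥0∞) (p : ℝ) {q : ℝ≥0∞}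
    (hq : q ≠ ∞) : lorentzNorm μ w p q f =
      (ENNReal.ofReal p * ∫⁻ s, ENNReal.ofReal s ^ q.toReal * wDist μ w f s ^ (q.toReal / p) ∂HH)
        ^ (1 / q.toReal) := by
  have := (wDist_anti μ w f).measurable
  unfold lorentzNorm
  rw [if_neg hq, lintegral_HH (by fun_prop)]

lemma key {α : Type*} [MeasurableSpace α] (μ : Measure α) {m A : ℝ} {v w : α → ℝ≥0∞}
    {T : (α → ℝ≥0∞) → (α → ℝ≥0∞)} {N : ℝ≥0∞} (hm : 0 < m) (hA : 0 < A)
    (h1 : ∀ x, T (fun _ => 1) x ≤ ENNReal.ofReal A)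
    (hadd : ∀ f g : α → ℝ≥0∞, Measurable f → Measurable g →
          ∀ x, T (fun y => f y + g y) x ≤ T f x + T g x)
    (hsm : ∀ f : α → ℝ≥0∞, Measurable f → ∀ c : ℝ≥0,
          ∀ x, T (fun y => (c : ℝ≥0∞) * f y) x = (c : ℝ≥0∞) * T f x)
    (hmono : ∀ f g : α → ℝ≥0∞, Measurable f → Measurable g → (∀ x, f x ≤ g x) →
          ∀ x, T f x ≤ T g x)
    (hN : ∀ f, Measurable f →
          lorentzNorm μ v m ∞ (T f) ≤ N * lorentzNorm μ w m (ENNReal.ofReal m) f)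
    {f : α → ℝ≥0∞} (hf : Measurable f) {s : ℝ} (hs : 0 < s) :
    wDist μ v (T f) ((1 + A) * s) ≤
      N ^ m * ∫⁻ u, ENNReal.ofReal m * (ENNReal.ofReal u ^ m * wDist μ w f (s * max 1 u)) ∂HH := by
  set S : Set α := {x | ENNReal.ofReal s < f x} with hS
  have hSm : MeasurableSet S := measurableSet_lt measurable_const hf
  set g := S.indicator f with hg
  set b := Sᶜ.indicator f with hb
  have hgm : Measurable g := hf.indicator hSm
  have hbm : Measurable b := hf.indicator hSm.compl
  have hLm := (wDist_anti μ w f).measurable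
  have hTb : ∀ x, T b x ≤ ENNReal.ofReal (s * A) := by
    intro x
    have e1 := hmono b (fun y => (s.toNNReal : ℝ≥0∞) * 1) hbm measurable_const (by
      intro y
      by_cases hy : y ∈ S
      · simp [hb, hy]
      · rw [hb, indicator_of_mem (by exact hy)]
        have : ¬ ENNReal.ofReal s < f y := hy
        rw [mul_one]; exact not_lt.1 this) x
    rw [hsm (fun _ => 1) measurable_const] at e1
    refine e1.trans ?_
    rw [ENNReal.ofReal_mul hs.le]
    exact mul_le_mul' le_rfl (h1 x)
  have hsub : {x | ENNReal.ofReal ((1 + A) * s) < T f x} ⊆ {x | ENNReal.ofReal s < T g x} := by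
    intro x hx
    have hx : ENNReal.ofReal ((1 + A) * s) < T f x := hx
    by_contra hc
    have hc : T g x ≤ ENNReal.ofReal s := not_lt.1 hc
    have e2 := hadd g b hgm hbm x
    have e3 : (fun y => g y + b y) = f := by
      have := indicator_self_add_compl S f
      exact this
    rw [e3] at e2
    have e4 := e2.trans (add_le_add hc (hTb x))
    rw [← ENNReal.ofReal_add hs.le (by positivity)] at e4
    rw [show (1 + A) * s = s + s * A by ring] at hx
    exact absurd hx (not_lt.2 e4)
  have hle : wDist μ v (T f) ((1 + A) * s) ≤ wDist μ v (T g) s := lintegral_mono_set hsub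
  refine hle.trans ?_
  have hwg : ∀ t, 0 < t → wDist μ w g t = wDist μ w f (max s t) := by
    intro t ht
    unfold wDist
    congr 2
    ext x
    rw [mem_ofPred_eq, mem_ofPred_eq]
    by_cases hx : x ∈ S
    · have : ENNReal.ofReal s < f x := hx
      rw [hg, indicator_of_mem hx, ENNReal.ofReal_max, max_lt_iff]
      simp [this]
    · have : ¬ ENNReal.ofReal s < f x := hx
      rw [hg, indicator_of_notMem hx, ENNReal.ofReal_max, max_lt_iff]
      simp [this]
  have h2 := hN g hgm
  rw [lorentz_fin _ _ _ _ ENNReal.ofReal_ne_top, ENNReal.toReal_ofReal hm.le, div_self hm.ne'] at h2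
  have h3 : ENNReal.ofReal s * wDist μ v (T g) s ^ (1 / m) ≤ lorentzNorm μ v m ∞ (T g) := by
    unfold lorentzNorm
    rw [if_pos rfl]
    exact le_iSup₂_of_le s hs le_rfl
  have h4 := ENNReal.rpow_le_rpow (h3.trans h2) hm.le
  rw [ENNReal.mul_rpow_of_nonneg _ _ hm.le, ENNReal.mul_rpow_of_nonneg _ _ hm.le, ← ENNReal.rpow_mul,
    ← ENNReal.rpow_mul, one_div_mul_cancel hm.ne', ENNReal.rpow_one, ENNReal.rpow_one] at h4
  have h5 : ∫⁻ t, ENNReal.ofReal t ^ m * wDist μ w g t ^ (1:ℝ) ∂HH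
      = ENNReal.ofReal s ^ m * ∫⁻ u, ENNReal.ofReal u ^ m * wDist μ w f (s * max 1 u) ∂HH := by
    have e5 : ∫⁻ t, ENNReal.ofReal t ^ m * wDist μ w g t ^ (1:ℝ) ∂HH
        = ∫⁻ t, ENNReal.ofReal t ^ m * wDist μ w f (max s t) ∂HH := by
      refine lintegral_congr_ae ?_
      filter_upwards [HH_pos] with t ht
      rw [hwg t ht, ENNReal.rpow_one]
    rw [e5, ← HH_scale (F := fun t => ENNReal.ofReal t ^ m * wDist μ w f (max s t)) (by fun_prop) hs,
      ← lintegral_const_mul _ (by fun_prop)]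
    refine lintegral_congr fun u => ?_
    rw [ENNReal.ofReal_mul hs.le, ENNReal.mul_rpow_of_nonneg _ _ hm.le, mul_max_of_nonneg _ _ hs.le, mul_one, mul_assoc]
  rw [h5] at h4
  rw [lintegral_const_mul _ (by fun_prop)]
  have hs0 : ENNReal.ofReal s ^ m ≠ 0 := by simp [hs]
  have hs1 : ENNReal.ofReal s ^ m ≠ ∞ := ENNReal.rpow_ne_top_of_nonneg hm.le (by simp)
  refine (ENNReal.mul_le_mul_iff_right hs0 hs1).1 (h4.trans_eq ?_)
  ring

lemma assemble {α : Type*} [MeasurableSpace α] (μ : Measure α) {p r A : ℝ} {q : ℝ≥0∞} {v w : α → ℝ≥0∞}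
    {g f : α → ℝ≥0∞} {N K : ℝ≥0∞} (hp : 0 < p) (hr : 0 < r) (hA : 0 < A) (hq : 0 < q) (hqt : q ≠ ∞)
    (hNt : N ≠ ∞)
    (hkey : ∀ s, 0 < s → wDist μ v g ((1 + A) * s) ≤ N ^ (p / r) *
      ∫⁻ u, ENNReal.ofReal (p / r) * (ENNReal.ofReal u ^ (p / r) * wDist μ w f (s * max 1 u)) ∂HH)
    (hK : ∫⁻ s, ENNReal.ofReal s ^ (p * (q.toReal / p)) *
        (∫⁻ u, ENNReal.ofReal (p / r) * (ENNReal.ofReal u ^ (p / r) * wDist μ w f (s * max 1 u)) ∂HH)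
          ^ (q.toReal / p) ∂HH
      ≤ K * ∫⁻ s, ENNReal.ofReal s ^ (p * (q.toReal / p)) * wDist μ w f s ^ (q.toReal / p) ∂HH) :
    lorentzNorm μ v p q g ≤ ENNReal.ofReal (1 + A) * K ^ (1 / q.toReal) * N ^ (1 / r) *
      lorentzNorm μ w p q f := by
  have hq0 : 0 < q.toReal := ENNReal.toReal_pos hq.ne' hqt
  have hLm := (wDist_anti μ w f).measurable
  have hVm := (wDist_anti μ v g).measurable
  rw [lorentz_fin _ _ _ _ hqt, lorentz_fin _ _ _ _ hqt]
  rw [mul_div_cancel₀ _ hp.ne'] at hK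
  have hA1 : 0 < 1 + A := by linarith
  have hap : 0 < q.toReal / p := by positivity
  have h1 : ∫⁻ s, ENNReal.ofReal s ^ q.toReal * wDist μ v g s ^ (q.toReal / p) ∂HH
      ≤ ENNReal.ofReal (1 + A) ^ q.toReal * (N ^ (1 / r * q.toReal) * (K *
        ∫⁻ s, ENNReal.ofReal s ^ q.toReal * wDist μ w f s ^ (q.toReal / p) ∂HH)) := by
    rw [← HH_scale (F := fun s => ENNReal.ofReal s ^ q.toReal * wDist μ v g s ^ (q.toReal / p))
      (by fun_prop) hA1]
    refine le_trans ?_ (mul_le_mul' le_rfl (mul_le_mul' le_rfl hK))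
    rw [← lintegral_const_mul _ (by fun_prop), ← lintegral_const_mul _ (by fun_prop)]
    refine lintegral_mono_ae ?_
    filter_upwards [HH_pos] with s hs
    rw [ENNReal.ofReal_mul hA1.le, ENNReal.mul_rpow_of_nonneg _ _ hq0.le, mul_assoc]
    refine mul_le_mul' le_rfl ?_
    refine (mul_le_mul' le_rfl (ENNReal.rpow_le_rpow (hkey s hs) hap.le)).trans_eq ?_
    rw [ENNReal.mul_rpow_of_nonneg _ _ hap.le, ← ENNReal.rpow_mul, mul_left_comm]
    congr 2
    field_simp
  have hi : 0 ≤ 1 / q.toReal := by positivity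
  refine (ENNReal.rpow_le_rpow (mul_le_mul' le_rfl h1) hi).trans_eq ?_
  simp only [ENNReal.mul_rpow_of_nonneg _ _ hi]
  rw [← ENNReal.rpow_mul, ← ENNReal.rpow_mul, mul_one_div_cancel hq0.ne', mul_assoc (1 / r),
    mul_one_div_cancel hq0.ne', mul_one, ENNReal.rpow_one]
  ring

universe u

/-- The main abstract theorem: if `T` is a positive sublinear operator with `T1 ≤ A·1`
which is bounded `L^{p/r}(w) → L^{p/r,∞}(v)`, then `T` is bounded `L^{p,q}(w) → L^{p,q}(v)`
with the stated quantitative bounds. -/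
theorem abstract_lorentz_bound :
    ∃ C : ℝ, 0 < C ∧
      ∀ (α : Type u) [MeasurableSpace α] (μ : Measure α) [SigmaFinite μ]
        (p : ℝ) (q : ℝ≥0∞) (r A : ℝ) (v w : α → ℝ≥0∞)
        (T : (α → ℝ≥0∞) → (α → ℝ≥0∞)) (N : ℝ≥0∞),
        1 < p → 0 < q → 1 < r → r < p → 0 < A →
        Measurable v → Measurable w →
        (∀ f, Measurable f → Measurable (T f)) →
        (∀ x, T (fun _ => 1) x ≤ ENNReal.ofReal A) →
        (∀ f g : α → ℝ≥0∞, Measurable f → Measurable g →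
          ∀ x, T (fun y => f y + g y) x ≤ T f x + T g x) →
        (∀ f : α → ℝ≥0∞, Measurable f → ∀ c : ℝ≥0,
          ∀ x, T (fun y => (c : ℝ≥0∞) * f y) x = (c : ℝ≥0∞) * T f x) →
        (∀ f g : α → ℝ≥0∞, Measurable f → Measurable g → (∀ x, f x ≤ g x) →
          ∀ x, T f x ≤ T g x) →
        N ≠ ∞ →
        (∀ f, Measurable f →
          lorentzNorm μ v (p / r) ∞ (T f) ≤
            N * lorentzNorm μ w (p / r) (ENNReal.ofReal (p / r)) f) →
        ∀ f, Measurable f →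
          (ENNReal.ofReal p ≤ q →
            lorentzNorm μ v p q (T f) ≤
              ENNReal.ofReal (C * (1 + A) * (r / (r - 1)) ^ (1 / p)) * N ^ (1 / r) *
                lorentzNorm μ w p q f) ∧
          (q ≤ ENNReal.ofReal p →
            lorentzNorm μ v p q (T f) ≤
              ENNReal.ofReal (C * (1 + A) * (4 * (r / (r - 1)) / q.toReal) ^ (1 / q.toReal)) *
                N ^ (1 / r) * lorentzNorm μ w p q f) := by
  refine ⟨2, two_pos, ?_⟩
  intro α _ μ _ p q r A v w T N hp hq hr hrp hA hv hw hTm h1 hadd hsm hmono hNt hN f hf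
  have hp0 : 0 < p := by linarith
  have hr0 : 0 < r := by linarith
  have hm : 0 < p / r := by positivity
  have hr1 : 0 < r - 1 := by linarith
  have hmp : p / r < p := div_lt_self hp0 hr
  have hrat : p / (p - p / r) = r / (r - 1) := by
    have : p - p / r = p * (r - 1) / r := by field_simp
    rw [this]; field_simp
  have hrp' : 0 < r / (r - 1) := by positivity
  have hL := wDist_anti μ w f
  have hLm := hL.measurable
  have hkey := fun s hs => key μ hm hA h1 hadd hsm hmono hN hf (s := s) hs
  constructor
  · intro hpq
    have hc : ENNReal.ofReal (1 + A) * ENNReal.ofReal (r / (r - 1)) ^ (1 / p)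
        ≤ ENNReal.ofReal (2 * (1 + A) * (r / (r - 1)) ^ (1 / p)) := by
      rw [ENNReal.ofReal_rpow_of_pos hrp', ← ENNReal.ofReal_mul (by positivity)]
      gcongr
      linarith
    by_cases hqt : q = ∞
    · subst hqt
      refine le_trans ?_ (mul_le_mul' (mul_le_mul' hc le_rfl) le_rfl)
      set K := lorentzNorm μ w p ∞ f with hK
      have hK' : ∀ t, 0 < t → wDist μ w f t ≤ K ^ p * ENNReal.ofReal t ^ (-p) := by
        intro t ht
        have e : ENNReal.ofReal t * wDist μ w f t ^ (1 / p) ≤ K := by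
          rw [hK]; unfold lorentzNorm
          rw [if_pos rfl]
          exact le_iSup₂_of_le t ht le_rfl
        have e2 := ENNReal.rpow_le_rpow e hp0.le
        rw [ENNReal.mul_rpow_of_nonneg _ _ hp0.le, ← ENNReal.rpow_mul, one_div_mul_cancel hp0.ne',
          ENNReal.rpow_one] at e2
        have e3 : ENNReal.ofReal t ^ p * ENNReal.ofReal t ^ (-p) = 1 := by
          rw [← ENNReal.rpow_add _ _ (by simpa) (by simp)]; simp
        calc _ = ENNReal.ofReal t ^ p * wDist μ w f t * ENNReal.ofReal t ^ (-p) := by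
              rw [mul_right_comm, e3, one_mul]
          _ ≤ _ := by gcongr
      unfold lorentzNorm
      rw [if_pos rfl]
      refine iSup₂_le fun t ht => ?_
      have hA1 : 0 < 1 + A := by linarith
      obtain ⟨s, hs, rfl⟩ : ∃ s, 0 < s ∧ t = (1 + A) * s := ⟨t / (1 + A), by positivity, by field_simp⟩
      have e4 : ∫⁻ u, ENNReal.ofReal (p / r) * (ENNReal.ofReal u ^ (p / r) * wDist μ w f (s * max 1 u)) ∂HH
          ≤ K ^ p * ENNReal.ofReal s ^ (-p) * ENNReal.ofReal (r / (r - 1)) := by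
        rw [← hrat, ← HH_kernel hm hmp, ← lintegral_const_mul _ (by fun_prop)]
        refine lintegral_mono fun u => ?_
        have hM : 0 < max 1 u := by positivity
        refine (mul_le_mul' le_rfl (mul_le_mul' le_rfl (hK' _ (mul_pos hs hM)))).trans_eq ?_
        rw [ENNReal.ofReal_mul hs.le, ENNReal.mul_rpow_of_ne_top (by simp) (by simp)]
        ring
      have e5 := (hkey s hs).trans (mul_le_mul' le_rfl e4)
      have hi : 0 ≤ 1 / p := by positivity
      refine (mul_le_mul' le_rfl (ENNReal.rpow_le_rpow e5 hi)).trans_eq ?_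
      simp only [ENNReal.mul_rpow_of_nonneg _ _ hi]
      rw [← ENNReal.rpow_mul, ← ENNReal.rpow_mul, ← ENNReal.rpow_mul, mul_one_div_cancel hp0.ne', neg_mul,
        mul_one_div_cancel hp0.ne', ENNReal.rpow_one, ENNReal.ofReal_mul hA1.le, ENNReal.rpow_neg_one,
        show p / r * (1 / p) = 1 / r by field_simp]
      have e6 : ENNReal.ofReal s * (ENNReal.ofReal s)⁻¹ = 1 := ENNReal.mul_inv_cancel (by simpa) (by simp)
      calc _ = ENNReal.ofReal (1 + A) * ENNReal.ofReal (r / (r - 1)) ^ (1 / p) * N ^ (1 / r) * K *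
            (ENNReal.ofReal s * (ENNReal.ofReal s)⁻¹) := by ring
        _ = _ := by rw [e6, mul_one]
    · have hq0 : 0 < q.toReal := ENNReal.toReal_pos hq.ne' hqt
      have hpq' : p ≤ q.toReal := (ENNReal.ofReal_le_iff_le_toReal hqt).1 hpq
      have ha : 1 ≤ q.toReal / p := by rwa [one_le_div hp0]
      refine (assemble μ hp0 hr0 hA hq hqt hNt hkey (hardy_ge hLm hm hmp ha)).trans ?_
      rw [hrat, ← ENNReal.rpow_mul, show q.toReal / p * (1 / q.toReal) = 1 / p by field_simp]
      exact mul_le_mul' (mul_le_mul' hc le_rfl) le_rfl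
  · intro hqp
    have hqt : q ≠ ∞ := ne_top_of_le_ne_top ENNReal.ofReal_ne_top hqp
    have hq0 : 0 < q.toReal := ENNReal.toReal_pos hq.ne' hqt
    have hpq' : q.toReal ≤ p := ENNReal.toReal_le_of_le_ofReal hp0.le hqp
    have ha : q.toReal / p ≤ 1 := by rwa [div_le_one hp0]
    refine (assemble μ hp0 hr0 hA hq hqt hNt hkey (hardy_le hL hm hmp (by positivity) ha)).trans ?_
    rw [hrat]
    refine mul_le_mul' (mul_le_mul' ?_ le_rfl) le_rfl
    have e2 : (2 : ℝ≥0∞) * ENNReal.ofReal (r / (r - 1)) = ENNReal.ofReal (2 * (r / (r - 1))) := by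
      rw [ENNReal.ofReal_mul (by norm_num)]; simp
    rw [e2, ENNReal.ofReal_rpow_of_pos (by positivity), ← ENNReal.ofReal_mul (by positivity)]
    refine ENNReal.ofReal_le_ofReal ?_
    have e3 : (2 * (r / (r - 1))) ^ (1 / q.toReal) ≤ 2 * (4 * (r / (r - 1)) / q.toReal) ^ (1 / q.toReal) := by
      have e4 : 2 * (r / (r - 1)) ≤ 2 ^ q.toReal * (4 * (r / (r - 1)) / q.toReal) := by
        have := le_two_rpow (x := q.toReal)
        generalize r / (r - 1) = y at hrp'
        rw [mul_div_assoc', le_div_iff₀ hq0]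
        nlinarith [mul_le_mul_of_nonneg_left this hrp'.le, mul_pos hrp' hq0]
      have e5 := Real.rpow_le_rpow (by positivity) e4 (z := 1 / q.toReal) (by positivity)
      rwa [Real.mul_rpow (x := 2 ^ q.toReal) (by positivity) (by positivity), ← Real.rpow_mul (by norm_num),
        mul_one_div_cancel hq0.ne', Real.rpow_one] at e5
    calc _ ≤ (1 + A) * (2 * (4 * (r / (r - 1)) / q.toReal) ^ (1 / q.toReal)) := by gcongr
      _ = _ := by ring
end
end

section
/- Let 1<p<∞. There is no constant C<∞ such that ‖M‖_{L^p(w)→L^p(w)} ≤ C([w]_{A_∞}[σ]_{A_∞})^{1/p} holds for all weights w on ℝ with [w]_{A_p}<∞, where σ = w^{1-p'}. Indeed, for the weights w_δ(x) = |x|^{(p-1)(1-δ)}, 0<δ<1, one has [w_δ]_{A_∞} ≤ C_p, [σ_δ]_{A_∞} ≤ C_p δ^{-1} and ‖M‖_{L^p(w_δ)→L^p(w_δ)} ≥ c_p δ^{-1} for constants 0<c_p,C_p<∞ depending only on p, so the ratio ‖M‖_{L^p(w_δ)}/([w_δ]_{A_∞}[σ_δ]_{A_∞})^{1/p} is unbounded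 as δ → 0. -/
open MeasureTheory ENNReal NNReal Set

noncomputable section

/-- The Hardy–Littlewood maximal operator on `ℝ` (over bounded intervals). -/
def maximal1 (f : ℝ → ℝ≥0∞) (x : ℝ) : ℝ≥0∞ :=
  ⨆ (a : ℝ) (b : ℝ) (_ : a < b) (_ : x ∈ Set.Icc a b),
    (∫⁻ y in Set.Icc a b, f y) / ENNReal.ofReal (b - a)

/-- The Muckenhoupt constant `[w]_{A_p}` on `ℝ`. -/
def Ap1 (p : ℝ) (w : ℝ → ℝ≥0∞) : ℝ≥0∞ :=
  ⨆ (a : ℝ) (b : ℝ) (_ : a < b),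
    ((∫⁻ x in Set.Icc a b, w x) / ENNReal.ofReal (b - a)) *
      ((∫⁻ x in Set.Icc a b, w x ^ (1 - conjExp p)) / ENNReal.ofReal (b - a)) ^ (p - 1)

/-- The Fujii–Wilson constant `[w]_{A_∞}` on `ℝ`. -/
def Ainf1 (w : ℝ → ℝ≥0∞) : ℝ≥0∞ :=
  ⨆ (a : ℝ) (b : ℝ) (_ : a < b),
    (∫⁻ x in Set.Icc a b, maximal1 ((Set.Icc a b).indicator w) x) / ∫⁻ x in Set.Icc a b, w x

/-- The weight `w_δ(x) = δ^{p-1}` for `|x| ≤ 1`, `|x|^{(1-δ)(p-1)}` for `|x| > 1`. -/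
def wdelta (p δ : ℝ) (x : ℝ) : ℝ≥0∞ :=
  if |x| ≤ 1 then ENNReal.ofReal (δ ^ (p - 1)) else ENNReal.ofReal (|x| ^ ((1 - δ) * (p - 1)))
/-- The power weight `|x|^{(p-1)(1-δ)}` on `ℝ`. -/
def wpow (p δ : ℝ) (x : ℝ) : ℝ≥0∞ := ENNReal.ofReal (|x| ^ ((p - 1) * (1 - δ)))

/-- The dual weight written out. -/
def sg (δ : ℝ) (x : ℝ) : ℝ≥0∞ := ENNReal.ofReal |x| ^ (δ - 1)

lemma sg_eq (p δ : ℝ) (hp : 1 < p) (hd1 : δ < 1) :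
    (fun x => wpow p δ x ^ (1 - conjExp p)) = sg δ := by
  funext x
  have h1 : 0 < (p - 1) * (1 - δ) := mul_pos (by linarith) (by linarith)
  have h2 : (p - 1) * (1 - δ) * (1 - conjExp p) = δ - 1 := by
    have : p - 1 ≠ 0 := by linarith
    unfold conjExp
    field_simp
    ring
  unfold wpow sg
  rw [← ENNReal.ofReal_rpow_of_nonneg (abs_nonneg x) h1.le, ← ENNReal.rpow_mul, h2]

lemma sg_of_ne (δ x : ℝ) (hx : x ≠ 0) : sg δ x = ENNReal.ofReal (|x| ^ (δ - 1)) := by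
  unfold sg
  rw [ENNReal.ofReal_rpow_of_pos (abs_pos.mpr hx)]

lemma sg_anti (δ x m : ℝ) (hd1 : δ < 1) (hxm : |x| ≤ m) (hm : 0 < m) :
    ENNReal.ofReal (m ^ (δ - 1)) ≤ sg δ x := by
  unfold sg
  rw [← ENNReal.ofReal_rpow_of_pos hm]
  have e : δ - 1 = -(1 - δ) := by ring
  rw [e, ENNReal.rpow_neg, ENNReal.rpow_neg]
  exact ENNReal.inv_le_inv.2
    (ENNReal.rpow_le_rpow (ENNReal.ofReal_le_ofReal hxm) (by linarith))

lemma sg_pos_int (δ t : ℝ) (hd : 0 < δ) (ht : 0 < t) :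
    ∫⁻ x in Ioc 0 t, sg δ x = ENNReal.ofReal (t ^ δ / δ) := by
  have h1 : ∫⁻ x in Ioc 0 t, sg δ x = ∫⁻ x in Ioc 0 t, ENNReal.ofReal (x ^ (δ - 1)) := by
    refine setLIntegral_congr_fun measurableSet_Ioc (fun x hx => ?_)
    rw [sg_of_ne δ x hx.1.ne', abs_of_pos hx.1]
  have hi : IntervalIntegrable (fun x : ℝ => x ^ (δ - 1)) volume 0 t :=
    intervalIntegral.intervalIntegrable_rpow' (by linarith)
  rw [h1, ← ofReal_integral_eq_lintegral_ofReal]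
  · rw [← intervalIntegral.integral_of_le ht.le, integral_rpow (Or.inl (by linarith))]
    congr 1
    rw [sub_add_cancel, Real.zero_rpow hd.ne', sub_zero]
  · exact (intervalIntegrable_iff_integrableOn_Ioc_of_le ht.le).1 hi
  · filter_upwards [ae_restrict_mem measurableSet_Ioc] with x hx
    exact Real.rpow_nonneg hx.1.le _

lemma sg_neg_int (δ t : ℝ) (hd : 0 < δ) (ht : 0 < t) :
    ∫⁻ x in Ico (-t) 0, sg δ x = ENNReal.ofReal (t ^ δ / δ) := by
  rw [← sg_pos_int δ t hd ht]
  have := (Measure.measurePreserving_neg (volume : Measure ℝ)).setLIntegral_comp_preimage_emb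
    (MeasurableEquiv.neg ℝ).measurableEmbedding (sg δ) (Ico (-t) 0)
  rw [← this]
  have e : (Neg.neg : ℝ → ℝ) ⁻¹' (Ico (-t) 0) = Ioc 0 t := by
    ext x
    simp only [mem_preimage, mem_Ico, mem_Ioc]
    constructor <;> rintro ⟨h1, h2⟩ <;> constructor <;> linarith
  rw [e]
  simp [sg]

lemma max_pos_of_lt {a b : ℝ} (hab : a < b) : 0 < max |a| |b| := by
  by_contra h
  push Not at h
  have h1 := abs_nonpos_iff.1 ((le_max_left _ _).trans h)
  have h2 := abs_nonpos_iff.1 ((le_max_right _ _).trans h)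
  linarith

lemma abs_le_max {a b x : ℝ} (hx : x ∈ Icc a b) : |x| ≤ max |a| |b| :=
  abs_le_max_abs_abs hx.1 hx.2

lemma len_le {a b : ℝ} : b - a ≤ 2 * max |a| |b| := by
  have := neg_le_abs a
  have := le_abs_self b
  have := le_max_left |a| |b|
  have := le_max_right |a| |b|
  linarith

lemma sg_int (δ a b : ℝ) (hd : 0 < δ) (hd1 : δ < 1) (hab : a < b) :
    ∫⁻ x in Icc a b, sg δ x ≤
      ENNReal.ofReal (4 / δ * (max |a| |b|) ^ (δ - 1)) * ENNReal.ofReal (b - a) := by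
  set m := max |a| |b| with hmdef
  have hm : 0 < m := max_pos_of_lt hab
  have hP : 0 < m ^ (δ - 1) := Real.rpow_pos_of_pos hm _
  rw [← ENNReal.ofReal_mul (by positivity)]
  rcases le_or_gt (m / 2) (b - a) with h | h
  · have hz : ∫⁻ x in ({0} : Set ℝ), sg δ x = 0 := by simp
    have hsub : Icc a b ⊆ (Ico (-m) 0 ∪ Ioc 0 m) ∪ {0} := by
      intro x hx
      have h1 := abs_le.1 (abs_le_max hx)
      rcases lt_trichotomy x 0 with h0 | h0 | h0
      · exact Or.inl (Or.inl ⟨h1.1, h0⟩)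
      · exact Or.inr h0
      · exact Or.inl (Or.inr ⟨h0, h1.2⟩)
    calc ∫⁻ x in Icc a b, sg δ x ≤ ∫⁻ x in (Ico (-m) 0 ∪ Ioc 0 m) ∪ {0}, sg δ x :=
          lintegral_mono_set hsub
      _ ≤ (∫⁻ x in Ico (-m) 0 ∪ Ioc 0 m, sg δ x) + ∫⁻ x in ({0} : Set ℝ), sg δ x :=
          lintegral_union_le _ _ _
      _ ≤ (∫⁻ x in Ico (-m) 0, sg δ x) + ∫⁻ x in Ioc 0 m, sg δ x := by
          rw [hz, add_zero]; exact lintegral_union_le _ _ _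
      _ = ENNReal.ofReal (m ^ δ / δ + m ^ δ / δ) := by
          rw [sg_neg_int δ m hd hm, sg_pos_int δ m hd hm, ENNReal.ofReal_add] <;> positivity
      _ ≤ _ := by
          apply ENNReal.ofReal_le_ofReal
          have e : m ^ δ = m ^ (δ - 1) * m := by
            rw [← Real.rpow_add_one hm.ne', sub_add_cancel]
          rw [e]
          have : m ^ (δ - 1) * m ≤ m ^ (δ - 1) * (2 * (b - a)) :=
            mul_le_mul_of_nonneg_left (by linarith) hP.le
          rw [← add_div, div_mul_eq_mul_div, div_mul_eq_mul_div]
          apply div_le_div_of_nonneg_right _ hd.le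
          linarith
  · have hlow : ∀ y ∈ Icc a b, m / 2 ≤ |y| := by
      intro y hy
      rcases max_choice |a| |b| with h' | h'
      · have := abs_sub_abs_le_abs_sub a y
        have h3 : |a - y| ≤ b - a := abs_le.2 ⟨by linarith [hy.2], by linarith [hy.1]⟩
        rw [← h', ← hmdef] at this
        linarith
      · have := abs_sub_abs_le_abs_sub b y
        have h3 : |b - y| ≤ b - a := abs_le.2 ⟨by linarith [hy.2], by linarith [hy.1]⟩
        rw [← h', ← hmdef] at this
        linarith
    have hpt : ∀ y ∈ Icc a b, sg δ y ≤ ENNReal.ofReal (2 * m ^ (δ - 1)) := by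
      intro y hy
      have h1 := hlow y hy
      have hy0 : y ≠ 0 := abs_pos.1 (by linarith)
      rw [sg_of_ne δ y hy0]
      apply ENNReal.ofReal_le_ofReal
      calc |y| ^ (δ - 1) ≤ (m / 2) ^ (δ - 1) :=
            Real.rpow_le_rpow_of_nonpos (by positivity) h1 (by linarith)
        _ = m ^ (δ - 1) * (2 : ℝ) ^ (1 - δ) := by
            rw [Real.div_rpow hm.le (by norm_num), div_eq_mul_inv,
              ← Real.rpow_neg (by norm_num), neg_sub]
        _ ≤ m ^ (δ - 1) * (2 : ℝ) ^ (1 : ℝ) := by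
            apply mul_le_mul_of_nonneg_left _ hP.le
            exact Real.rpow_le_rpow_of_exponent_le (by norm_num) (by linarith)
        _ = _ := by rw [Real.rpow_one, mul_comm]
    calc ∫⁻ x in Icc a b, sg δ x ≤ ∫⁻ x in Icc a b, ENNReal.ofReal (2 * m ^ (δ - 1)) :=
          setLIntegral_mono measurable_const hpt
      _ = ENNReal.ofReal (2 * m ^ (δ - 1) * (b - a)) := by
          rw [setLIntegral_const, Real.volume_Icc, ← ENNReal.ofReal_mul (by positivity)]
      _ ≤ _ := by
          apply ENNReal.ofReal_le_ofReal
          apply mul_le_mul_of_nonneg_right _ (by linarith)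
          apply mul_le_mul_of_nonneg_right _ hP.le
          rw [le_div_iff₀ hd]
          linarith

lemma avg_sg (δ a b : ℝ) (hd : 0 < δ) (hd1 : δ < 1) (hab : a < b) :
    (∫⁻ x in Icc a b, sg δ x) / ENNReal.ofReal (b - a) ≤
      ENNReal.ofReal (4 / δ * (max |a| |b|) ^ (δ - 1)) :=
  ENNReal.div_le_of_le_mul (sg_int δ a b hd hd1 hab)

lemma maximal_sg (δ x : ℝ) (hd : 0 < δ) (hd1 : δ < 1) :
    maximal1 (sg δ) x ≤ ENNReal.ofReal (4 / δ) * sg δ x := by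
  refine iSup_le fun a => iSup_le fun b => iSup_le fun hab => iSup_le fun hx => ?_
  refine (avg_sg δ a b hd hd1 hab).trans ?_
  rw [ENNReal.ofReal_mul (by positivity)]
  gcongr
  exact sg_anti δ x _ hd1 (abs_le_max hx) (max_pos_of_lt hab)

lemma maximal_mono {f g : ℝ → ℝ≥0∞} (h : ∀ x, f x ≤ g x) (x : ℝ) :
    maximal1 f x ≤ maximal1 g x := by
  unfold maximal1
  gcongr
  exact h _

lemma sg_meas (δ : ℝ) : Measurable (sg δ) := by
  unfold sg
  fun_prop

lemma wpow_meas (p δ : ℝ) : Measurable (wpow p δ) := by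
  unfold wpow
  fun_prop

lemma Ainf_sg (δ : ℝ) (hd : 0 < δ) (hd1 : δ < 1) : Ainf1 (sg δ) ≤ ENNReal.ofReal (4 / δ) := by
  refine iSup_le fun a => iSup_le fun b => iSup_le fun hab => ?_
  refine ENNReal.div_le_of_le_mul ?_
  rw [← lintegral_const_mul _ (sg_meas δ)]
  refine lintegral_mono fun x => ?_
  exact (maximal_mono (fun y => indicator_le_self _ _ y) x).trans (maximal_sg δ x hd hd1)

lemma wpow_le (p δ x m : ℝ) (hp : 1 < p) (hd1 : δ < 1) (h : |x| ≤ m) :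
    wpow p δ x ≤ ENNReal.ofReal (m ^ ((p - 1) * (1 - δ))) := by
  have h1 : 0 < (p - 1) * (1 - δ) := mul_pos (by linarith) (by linarith)
  exact ENNReal.ofReal_le_ofReal (Real.rpow_le_rpow (abs_nonneg _) h h1.le)

lemma avg_wpow (p δ a b : ℝ) (hp : 1 < p) (hd1 : δ < 1) (hab : a < b) :
    (∫⁻ x in Icc a b, wpow p δ x) / ENNReal.ofReal (b - a) ≤
      ENNReal.ofReal ((max |a| |b|) ^ ((p - 1) * (1 - δ))) := by
  refine ENNReal.div_le_of_le_mul ?_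
  calc _ ≤ ∫⁻ x in Icc a b, ENNReal.ofReal ((max |a| |b|) ^ ((p - 1) * (1 - δ))) :=
        setLIntegral_mono measurable_const
          (fun x hx => wpow_le p δ x _ hp hd1 (abs_le_max hx))
    _ = _ := by rw [setLIntegral_const, Real.volume_Icc]

lemma maximal_le_const (f : ℝ → ℝ≥0∞) (K : ℝ≥0∞) (h : ∀ x, f x ≤ K) (x : ℝ) :
    maximal1 f x ≤ K := by
  refine iSup_le fun a => iSup_le fun b => iSup_le fun hab => iSup_le fun hx => ?_
  refine ENNReal.div_le_of_le_mul ?_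
  calc _ ≤ ∫⁻ x in Icc a b, K := lintegral_mono h
    _ = _ := by rw [setLIntegral_const, Real.volume_Icc]

lemma wpow_lower (p δ a b : ℝ) (hp : 1 < p) (hd1 : δ < 1) (hab : a < b) :
    ENNReal.ofReal ((max |a| |b| / 2) ^ ((p - 1) * (1 - δ)) * ((b - a) / 4)) ≤
      ∫⁻ x in Icc a b, wpow p δ x := by
  have hal : 0 < (p - 1) * (1 - δ) := mul_pos (by linarith) (by linarith)
  set m := max |a| |b| with hmdef
  have hm : 0 < m := max_pos_of_lt hab
  have hlen : b - a ≤ 2 * m := len_le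
  have key : ∀ c d : ℝ, d - c = (b - a) / 4 → Icc c d ⊆ Icc a b →
      (∀ y ∈ Icc c d, m / 2 ≤ |y|) →
      ENNReal.ofReal ((m / 2) ^ ((p - 1) * (1 - δ)) * ((b - a) / 4)) ≤
      ∫⁻ x in Icc a b, wpow p δ x := by
    intro c d hcd hs hy
    calc _ = ∫⁻ x in Icc c d, ENNReal.ofReal ((m / 2) ^ ((p - 1) * (1 - δ))) := by
          rw [setLIntegral_const, Real.volume_Icc, hcd, ENNReal.ofReal_mul (by positivity)]
      _ ≤ ∫⁻ x in Icc c d, wpow p δ x := by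
          refine setLIntegral_mono (wpow_meas p δ) fun y h => ?_
          exact ENNReal.ofReal_le_ofReal (Real.rpow_le_rpow (by positivity) (hy y h) hal.le)
      _ ≤ _ := lintegral_mono_set hs
  rcases max_choice |a| |b| with h' | h'
  · refine key a (a + (b - a) / 4) (by ring) (Icc_subset_Icc le_rfl (by linarith)) ?_
    intro y hy
    have := abs_sub_abs_le_abs_sub a y
    have h3 : |a - y| ≤ (b - a) / 4 := abs_le.2 ⟨by linarith [hy.2], by linarith [hy.1]⟩
    rw [← h', ← hmdef] at this
    linarith
  · refine key (b - (b - a) / 4) b (by ring) (Icc_subset_Icc (by linarith) le_rfl) ?_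
    intro y hy
    have := abs_sub_abs_le_abs_sub b y
    have h3 : |b - y| ≤ (b - a) / 4 := abs_le.2 ⟨by linarith [hy.2], by linarith [hy.1]⟩
    rw [← h', ← hmdef] at this
    linarith

lemma Ainf_wpow (p δ : ℝ) (hp : 1 < p) (hd : 0 < δ) (hd1 : δ < 1) :
    Ainf1 (wpow p δ) ≤ ENNReal.ofReal (4 * 2 ^ p) := by
  refine iSup_le fun a => iSup_le fun b => iSup_le fun hab => ?_
  refine ENNReal.div_le_of_le_mul ?_
  set m := max |a| |b| with hmdef
  have hm : 0 < m := max_pos_of_lt hab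
  have hba : 0 < b - a := by linarith
  set al := (p - 1) * (1 - δ) with hal
  calc ∫⁻ x in Icc a b, maximal1 ((Icc a b).indicator (wpow p δ)) x
      ≤ ∫⁻ x in Icc a b, ENNReal.ofReal (m ^ al) := by
        refine lintegral_mono fun x => maximal_le_const _ _ (fun y => ?_) x
        by_cases hy : y ∈ Icc a b
        · rw [indicator_of_mem hy]
          exact wpow_le p δ y m hp hd1 (abs_le_max hy)
        · rw [indicator_of_notMem hy]
          exact zero_le
    _ = ENNReal.ofReal (m ^ al * (b - a)) := by
        rw [setLIntegral_const, Real.volume_Icc, ENNReal.ofReal_mul (by positivity)]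
    _ ≤ ENNReal.ofReal (4 * 2 ^ p) * ENNReal.ofReal ((m / 2) ^ al * ((b - a) / 4)) := by
        rw [← ENNReal.ofReal_mul (by positivity)]
        apply ENNReal.ofReal_le_ofReal
        rw [Real.div_rpow hm.le (by norm_num)]
        have h2 : (2 : ℝ) ^ al ≤ 2 ^ p := by
          apply Real.rpow_le_rpow_of_exponent_le (by norm_num)
          rw [hal]; nlinarith
        have h3 : (0 : ℝ) < 2 ^ al := by positivity
        have h4 : 1 ≤ (2 : ℝ) ^ p / 2 ^ al := (one_le_div h3).2 h2
        have h5 : 0 ≤ m ^ al * (b - a) := by positivity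
        calc m ^ al * (b - a) = m ^ al * (b - a) * 1 := by ring
          _ ≤ m ^ al * (b - a) * ((2 : ℝ) ^ p / 2 ^ al) := mul_le_mul_of_nonneg_left h4 h5
          _ = _ := by ring
    _ ≤ _ := by
        gcongr
        exact wpow_lower p δ a b hp hd1 hab

lemma Ap_wpow (p δ : ℝ) (hp : 1 < p) (hd : 0 < δ) (hd1 : δ < 1) :
    Ap1 p (wpow p δ) ≠ ∞ := by
  have : Ap1 p (wpow p δ) ≤ ENNReal.ofReal ((4 / δ) ^ (p - 1)) := by
    refine iSup_le fun a => iSup_le fun b => iSup_le fun hab => ?_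
    have hm : 0 < max |a| |b| := max_pos_of_lt hab
    have e := sg_eq p δ hp hd1
    have e' : ∀ x, wpow p δ x ^ (1 - conjExp p) = sg δ x := fun x => congrFun e x
    simp only [e']
    calc _ ≤ ENNReal.ofReal ((max |a| |b|) ^ ((p - 1) * (1 - δ))) *
          (ENNReal.ofReal (4 / δ * (max |a| |b|) ^ (δ - 1))) ^ (p - 1) := by
          apply mul_le_mul' (avg_wpow p δ a b hp hd1 hab)
          exact ENNReal.rpow_le_rpow (avg_sg δ a b hd hd1 hab) (by linarith)
      _ = _ := by
          rw [ENNReal.ofReal_rpow_of_pos (by positivity), ← ENNReal.ofReal_mul (by positivity),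
            Real.mul_rpow (by positivity) (by positivity), ← Real.rpow_mul hm.le, mul_left_comm,
            ← Real.rpow_add hm]
          have : (p - 1) * (1 - δ) + (δ - 1) * (p - 1) = 0 := by ring
          rw [this, Real.rpow_zero, mul_one]
  exact ne_top_of_le_ne_top ENNReal.ofReal_ne_top this

lemma norm_lower (p δ : ℝ) (hp : 1 < p) (hd : 0 < δ) (hd1 : δ < 1) (C' : ℝ≥0∞)
    (H : ∀ f : ℝ → ℝ≥0∞, Measurable f →
          (∫⁻ x, maximal1 f x ^ p * wpow p δ x) ^ (1 / p) ≤
            C' * (∫⁻ x, f x ^ p * wpow p δ x) ^ (1 / p)) :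
    ENNReal.ofReal (1 / δ) ≤ C' := by
  have hp0 : 0 < p := by linarith
  set f : ℝ → ℝ≥0∞ := (Ioc (0 : ℝ) 1).indicator (sg δ) with hf
  have hfm : Measurable f := (sg_meas δ).indicator measurableSet_Ioc
  have hA : ∫⁻ x, f x ^ p * wpow p δ x = ENNReal.ofReal (1 / δ) := by
    have e : (fun x => f x ^ p * wpow p δ x) = (Ioc (0 : ℝ) 1).indicator (sg δ) := by
      funext x
      by_cases hx : x ∈ Ioc (0 : ℝ) 1
      · rw [hf, indicator_of_mem hx, sg_of_ne δ x hx.1.ne', abs_of_pos hx.1]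
        have hx0 := hx.1
        unfold wpow
        rw [ENNReal.ofReal_rpow_of_pos (by positivity), abs_of_pos hx0,
          ← ENNReal.ofReal_mul (by positivity), ← Real.rpow_mul hx0.le, ← Real.rpow_add hx0]
        congr 2
        ring
      · rw [hf, indicator_of_notMem hx, ENNReal.zero_rpow_of_pos hp0, zero_mul]
    rw [e, lintegral_indicator measurableSet_Ioc, sg_pos_int δ 1 hd one_pos, Real.one_rpow]
  have hpt : ∀ x, ENNReal.ofReal (1 / δ) * f x ≤ maximal1 f x := by
    intro x
    by_cases hx : x ∈ Ioc (0 : ℝ) 1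
    · have hx0 := hx.1
      have hI : ENNReal.ofReal (x ^ δ / δ) ≤ ∫⁻ y in Icc 0 x, f y := by
        rw [← sg_pos_int δ x hd hx0]
        calc ∫⁻ y in Ioc 0 x, sg δ y = ∫⁻ y in Ioc 0 x, f y := by
              refine setLIntegral_congr_fun measurableSet_Ioc (fun y hy => ?_)
              simp only [hf]
              rw [indicator_of_mem (show y ∈ Ioc (0 : ℝ) 1 from ⟨hy.1, hy.2.trans hx.2⟩)]
          _ ≤ _ := lintegral_mono_set Ioc_subset_Icc_self
      have hM : (∫⁻ y in Icc 0 x, f y) / ENNReal.ofReal (x - 0) ≤ maximal1 f x :=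
        le_iSup_of_le 0 (le_iSup_of_le x (le_iSup_of_le hx0
          (le_iSup_of_le ⟨hx0.le, le_rfl⟩ le_rfl)))
      refine le_trans ?_ hM
      refine le_trans ?_ (ENNReal.div_le_div_right hI _)
      rw [hf, indicator_of_mem hx, sg_of_ne δ x hx0.ne', abs_of_pos hx0, sub_zero,
        ← ENNReal.ofReal_div_of_pos hx0, ← ENNReal.ofReal_mul (by positivity)]
      apply ENNReal.ofReal_le_ofReal
      rw [Real.rpow_sub_one hx0.ne']
      apply le_of_eq
      field_simp
    · rw [hf, indicator_of_notMem hx, mul_zero]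
      exact zero_le
  have h := H f hfm
  have hB : (ENNReal.ofReal (1 / δ)) ^ p * ∫⁻ x, f x ^ p * wpow p δ x ≤
      ∫⁻ x, maximal1 f x ^ p * wpow p δ x := by
    have hmm : Measurable fun x => f x ^ p * wpow p δ x := (hfm.pow_const p).mul (wpow_meas p δ)
    rw [← lintegral_const_mul _ hmm]
    refine lintegral_mono fun x => ?_
    rw [← mul_assoc, ← ENNReal.mul_rpow_of_nonneg _ _ hp0.le]
    gcongr
    exact hpt x
  have h2 := (ENNReal.rpow_le_rpow hB (by positivity : 0 ≤ 1 / p)).trans h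
  rw [ENNReal.mul_rpow_of_nonneg _ _ (by positivity), ← ENNReal.rpow_mul,
    mul_one_div_cancel hp0.ne', ENNReal.rpow_one, hA] at h2
  have hpos : 0 < ENNReal.ofReal (1 / δ) := ENNReal.ofReal_pos.2 (by positivity)
  refine (ENNReal.mul_le_mul_iff_left ?_ ?_).1 h2
  · exact (ENNReal.rpow_pos hpos ENNReal.ofReal_ne_top).ne'
  · exact ENNReal.rpow_ne_top_of_nonneg (by positivity) ENNReal.ofReal_ne_top

lemma no_const (p : ℝ) (hp : 1 < p) (C : ℝ≥0∞) (hC : C ≠ ∞) (K : ℝ) (hK : 0 < K)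
    (H : ∀ δ : ℝ, 0 < δ → δ < 1 → ENNReal.ofReal (1 / δ) ≤
      C * (ENNReal.ofReal K * ENNReal.ofReal (K / δ)) ^ (1 / p)) : False := by
  have hp0 : 0 < p := by linarith
  have hq : 0 < 1 - 1 / p := by
    have : 1 / p < 1 := (div_lt_one hp0).2 hp
    linarith
  have ht := (_root_.tendsto_rpow_atTop hq).eventually_gt_atTop (C.toReal * (K * K) ^ (1 / p))
  obtain ⟨t, h1, h2⟩ := (ht.and (Filter.eventually_gt_atTop 1)).exists
  have ht0 : 0 < t := by linarith
  have h := H t⁻¹ (by positivity) (inv_lt_one_of_one_lt₀ h2)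
  rw [← ENNReal.ofReal_toReal hC, ← ENNReal.ofReal_mul hK.le,
    ENNReal.ofReal_rpow_of_pos (by positivity), ← ENNReal.ofReal_mul (by positivity),
    ENNReal.ofReal_le_ofReal_iff (by positivity)] at h
  have e : K * (K / t⁻¹) = (K * K) * t := by field_simp
  rw [e, Real.mul_rpow (by positivity) ht0.le, one_div, inv_inv, ← mul_assoc] at h
  have e2 : t = t ^ (1 - 1 / p) * t ^ (1 / p) := by
    rw [← Real.rpow_add ht0, sub_add_cancel, Real.rpow_one]
  have h3 : 0 < t ^ (1 / p) := by positivity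
  rw [one_div] at *
  have := mul_lt_mul_of_pos_right h1 h3
  rw [← e2] at this
  linarith

/-- The estimate `‖M‖_{L^p(w)} ≤ C([w]_{A_∞}[σ]_{A_∞})^{1/p}` is false: no finite `C` works
for all `A_p` weights, as witnessed by the weights `w_δ(x) = |x|^{(p-1)(1-δ)}`. -/
theorem double_Ainfty_bound_false (p : ℝ) (hp : 1 < p) :
    (¬ ∃ C : ℝ≥0∞, C ≠ ∞ ∧
        ∀ w : ℝ → ℝ≥0∞, Measurable w → Ap1 p w ≠ ∞ →
          ∀ f : ℝ → ℝ≥0∞, Measurable f →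
            (∫⁻ x, maximal1 f x ^ p * w x) ^ (1 / p) ≤
              C * (Ainf1 w * Ainf1 fun x => w x ^ (1 - conjExp p)) ^ (1 / p) *
                (∫⁻ x, f x ^ p * w x) ^ (1 / p)) ∧
    ∃ c C : ℝ, 0 < c ∧ 0 < C ∧ ∀ δ : ℝ, 0 < δ → δ < 1 →
      Ainf1 (wpow p δ) ≤ ENNReal.ofReal C ∧
      Ainf1 (fun x => wpow p δ x ^ (1 - conjExp p)) ≤ ENNReal.ofReal (C / δ) ∧
      ∀ C' : ℝ≥0∞,
        (∀ f : ℝ → ℝ≥0∞, Measurable f →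
          (∫⁻ x, maximal1 f x ^ p * wpow p δ x) ^ (1 / p) ≤
            C' * (∫⁻ x, f x ^ p * wpow p δ x) ^ (1 / p)) →
        ENNReal.ofReal (c / δ) ≤ C' := by
  have hK : (0 : ℝ) < 4 * 2 ^ p := by positivity
  have hS : ∀ δ : ℝ, 0 < δ → δ < 1 →
      Ainf1 (fun x => wpow p δ x ^ (1 - conjExp p)) ≤ ENNReal.ofReal (4 * 2 ^ p / δ) := by
    intro δ hd hd1
    rw [sg_eq p δ hp hd1]
    refine (Ainf_sg δ hd hd1).trans (ENNReal.ofReal_le_ofReal ?_)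
    have : (1 : ℝ) ≤ 2 ^ p := Real.one_le_rpow (by norm_num) (by linarith)
    apply div_le_div_of_nonneg_right _ hd.le
    linarith
  refine ⟨?_, 1, 4 * 2 ^ p, one_pos, hK, fun δ hd hd1 =>
    ⟨Ainf_wpow p δ hp hd hd1, hS δ hd hd1, fun C' H => norm_lower p δ hp hd hd1 C' H⟩⟩
  rintro ⟨C, hC, H⟩
  refine no_const p hp C hC _ hK fun δ hd hd1 => ?_
  refine (norm_lower p δ hp hd hd1 _ (H (wpow p δ) (wpow_meas p δ) (Ap_wpow p δ hp hd hd1))).trans ?_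
  gcongr
  · exact Ainf_wpow p δ hp hd hd1
  · exact hS δ hd hd1
end
end
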